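/- arXiv:math/0211276 — 10 statements merged into one kernel-verified Lean document; each statement's English description precedes it below -/
import Mathlib

section
/- Let m, n, p ≥ 2 be integers. The set of pairs (i,j) ∈ ℤ² satisfying at least two of the three conditions (a) −(m−1) ≤ i ≤ n−1, (b) −(m−1) ≤ j ≤ p−1, (c) −(n−1) ≤ j−i ≤ p−1, is finite and has cardinality (m²+n²+p²)+(mn+mp+np)−2(m+n+p)+1. (This set is exactly the set of divisor classes (i,j) for which the class module M_{(i,j)} of the Segre product of three polynomial rings in m, n, p variables is Cohen–Macaulay, so this number is the number of Cohen–Macaulay classes.) -/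
/-- The set of classes `(i,j) ∈ ℤ²` satisfying at least two of the three conditions
`-(m-1) ≤ i ≤ n-1`, `-(m-1) ≤ j ≤ p-1`, `-(n-1) ≤ j-i ≤ p-1`; these are exactly the
Cohen–Macaulay classes of the Segre product of three polynomial rings in `m`, `n`, `p`
variables. -/
def cohenMacaulayClasses (m n p : ℤ) : Set (ℤ × ℤ) :=
  {q : ℤ × ℤ |
    ((-(m - 1) ≤ q.1 ∧ q.1 ≤ n - 1) ∧ (-(m - 1) ≤ q.2 ∧ q.2 ≤ p - 1)) ∨
    ((-(m - 1) ≤ q.1 ∧ q.1 ≤ n - 1) ∧ (-(n - 1) ≤ q.2 - q.1 ∧ q.2 - q.1 ≤ p - 1)) ∨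
    ((-(m - 1) ≤ q.2 ∧ q.2 ≤ p - 1) ∧ (-(n - 1) ≤ q.2 - q.1 ∧ q.2 - q.1 ≤ p - 1))}

/-- Cuts a rectangle along its diagonal and moves the two triangles to the regions `p ≤ j` and
`j ≤ -m` of the plane. -/
def splitTriangles (m p : ℤ) (q : ℤ × ℤ) : ℤ × ℤ :=
  if q.2 ≤ q.1 then (q.1, q.1 + p - q.2) else (q.1 + 1 - m, q.1 + 1 - m - q.2)

/-- The part of the plane where the first and third conditions hold but the second fails. -/
noncomputable def outerTriangles (m n p : ℤ) : Finset (ℤ × ℤ) :=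
  (Finset.Icc 0 (n - 1) ×ˢ Finset.Icc 1 (n - 1)).image (splitTriangles m p)

theorem mem_outerTriangles {m n p : ℤ} (hm : 1 ≤ m) (hp : 1 ≤ p) (i j : ℤ) :
    (i, j) ∈ outerTriangles m n p ↔
      (-(m - 1) ≤ i ∧ i ≤ n - 1) ∧ (-(n - 1) ≤ j - i ∧ j - i ≤ p - 1) ∧ (p ≤ j ∨ j ≤ -m) := by
  simp only [outerTriangles, splitTriangles, Finset.mem_image, Finset.mem_product,
    Finset.mem_Icc, Prod.exists]
  constructor
  · rintro ⟨x, y, hxy, h⟩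
    split_ifs at h <;> simp only [Prod.mk.injEq] at h <;> omega
  · rintro ⟨hi, hd, hj | hj⟩
    · refine ⟨i, i + p - j, by omega, ?_⟩
      rw [if_pos (by omega)]
      exact Prod.ext rfl (by dsimp only; omega)
    · refine ⟨i + m - 1, i - j, by omega, ?_⟩
      rw [if_neg (by omega)]
      exact Prod.ext (by dsimp only; omega) (by dsimp only; omega)

theorem card_outerTriangles {m n p : ℤ} (hm : 1 ≤ m) (hn : 1 ≤ n) (hp : 1 ≤ p) :
    ((outerTriangles m n p).card : ℤ) = n * (n - 1) := by
  rw [outerTriangles, Finset.card_image_of_injOn, Finset.card_product, Int.card_Icc, Int.card_Icc]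
  · push_cast
    rw [Int.toNat_of_nonneg (by omega), Int.toNat_of_nonneg (by omega)]
    ring
  · rintro ⟨x, y⟩ hxy ⟨z, w⟩ hzw h
    simp only [Finset.coe_product, Finset.coe_Icc, Set.mem_prod, Set.mem_Icc] at hxy hzw
    simp only [splitTriangles] at h
    split_ifs at h <;> simp only [Prod.mk.injEq] at h ⊢ <;> omega

theorem cohenMacaulayClasses_eq_coe {m n p : ℤ} (hm : 1 ≤ m) (hn : 1 ≤ n) (hp : 1 ≤ p) :
    cohenMacaulayClasses m n p =
      ↑((Finset.Icc (-(m - 1)) (n - 1) ×ˢ Finset.Icc (-(m - 1)) (p - 1) ∪ outerTriangles m n p) ∪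
        (outerTriangles m p n).map (Equiv.prodComm ℤ ℤ).toEmbedding) := by
  ext ⟨i, j⟩
  simp only [cohenMacaulayClasses, Set.mem_ofPred_eq, Finset.mem_coe, Finset.mem_union,
    Finset.mem_product, Finset.mem_Icc, Finset.mem_map_equiv, Equiv.prodComm_symm,
    Equiv.prodComm_apply, Prod.swap_prod_mk, mem_outerTriangles hm hp, mem_outerTriangles hm hn]
  omega

theorem card_cohenMacaulayClasses (m n p : ℤ) (hm : 2 ≤ m) (hn : 2 ≤ n) (hp : 2 ≤ p) :
    (cohenMacaulayClasses m n p).Finite ∧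
      ((cohenMacaulayClasses m n p).ncard : ℤ) =
        (m ^ 2 + n ^ 2 + p ^ 2) + (m * n + m * p + n * p) - 2 * (m + n + p) + 1 := by
  have hm' : 1 ≤ m := by omega
  have hn' : 1 ≤ n := by omega
  have hp' : 1 ≤ p := by omega
  rw [cohenMacaulayClasses_eq_coe hm' hn' hp']
  refine ⟨Finset.finite_toSet _, ?_⟩
  rw [Set.ncard_coe_finset, Finset.card_union_of_disjoint, Finset.card_union_of_disjoint,
    Finset.card_map, Finset.card_product, Int.card_Icc, Int.card_Icc]
  · push_cast
    rw [card_outerTriangles hm' hn' hp', card_outerTriangles hm' hp' hn',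
      Int.toNat_of_nonneg (by omega), Int.toNat_of_nonneg (by omega)]
    ring
  · rw [Finset.disjoint_left]
    rintro ⟨i, j⟩
    simp only [Finset.mem_product, Finset.mem_Icc, mem_outerTriangles hm' hp']
    omega
  · rw [Finset.disjoint_left]
    rintro ⟨i, j⟩
    simp only [Finset.mem_union, Finset.mem_product, Finset.mem_Icc, Finset.mem_map_equiv,
      Equiv.prodComm_symm, Equiv.prodComm_apply, Prod.swap_prod_mk,
      mem_outerTriangles hm' hp', mem_outerTriangles hm' hn']
    omega
end

section
/- Let m, n, p ≥ 2 be integers. The set { (⌈a−b⌉, ⌈a−c⌉) ∈ ℤ² : a, b, c ∈ ℝ, −m < a ≤ 0, −(n−1) < b ≤ 0, −(p−1) < c ≤ 0 } is finite and has cardinality (mn+mp+np)−(m+n+p)+1. (This set parametrizes the conic divisor classes of the Segre product of three polynomial rings in m, n, p variables.) -/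
/-- The set of pairs `(⌈a-b⌉, ⌈a-c⌉)` with `a ∈ (-m, 0]`, `b ∈ (-(n-1), 0]`,
`c ∈ (-(p-1), 0]` real; these parametrize the conic divisor classes of the Segre
product of three polynomial rings in `m`, `n`, `p` variables. -/
def conicClasses (m n p : ℤ) : Set (ℤ × ℤ) :=
  {q : ℤ × ℤ | ∃ a b c : ℝ,
    (-(m : ℝ) < a ∧ a ≤ 0) ∧ (-((n : ℝ) - 1) < b ∧ b ≤ 0) ∧ (-((p : ℝ) - 1) < c ∧ c ≤ 0) ∧
    q = (⌈a - b⌉, ⌈a - c⌉)}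

/-- An integer `t` with `i - n < t ≤ i` can be shifted by some `b ∈ (-(n - 1), 0]` so that
`⌈t - b⌉ = i`. -/
lemma exists_ceil_sub_eq {n t i : ℤ} (hn : 2 ≤ n) (h₁ : i - n < t) (h₂ : t ≤ i) :
    ∃ b : ℝ, (-((n : ℝ) - 1) < b ∧ b ≤ 0) ∧ ⌈(t : ℝ) - b⌉ = i := by
  rcases h₂.eq_or_lt with rfl | h
  · have hn' : (2 : ℝ) ≤ n := by exact_mod_cast hn
    exact ⟨0, ⟨by linarith, le_rfl⟩, by simp⟩
  · have h₁' : (i : ℝ) - n + 1 ≤ t := by exact_mod_cast h₁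
    have h' : (t : ℝ) + 1 ≤ i := by exact_mod_cast h
    refine ⟨t - i + 1 / 2, ⟨by linarith, by linarith⟩, ?_⟩
    rw [Int.ceil_eq_iff]
    constructor <;> linarith

lemma mem_conicClasses_iff {m n p : ℤ} (hm : 2 ≤ m) (hn : 2 ≤ n) (hp : 2 ≤ p) (i j : ℤ) :
    (i, j) ∈ conicClasses m n p ↔
      (-m < i ∧ i < n) ∧ (-m < j ∧ j < p) ∧ (-p < i - j ∧ i - j < n) := by
  constructor
  · rintro ⟨a, b, c, ⟨ha₁, ha₂⟩, ⟨hb₁, hb₂⟩, ⟨hc₁, hc₂⟩, h⟩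
    obtain ⟨hi, hj⟩ := Prod.mk.inj h
    obtain ⟨hi₁, hi₂⟩ := Int.ceil_eq_iff.mp hi.symm
    obtain ⟨hj₁, hj₂⟩ := Int.ceil_eq_iff.mp hj.symm
    refine ⟨⟨?_, ?_⟩, ⟨?_, ?_⟩, ?_, ?_⟩ <;> rify <;> linarith
  · rintro ⟨⟨hi₁, hi₂⟩, ⟨hj₁, hj₂⟩, hd₁, hd₂⟩
    obtain ⟨t, ht⟩ : ∃ t, t = min 0 (min i j) := ⟨_, rfl⟩
    obtain ⟨b, hb, hbi⟩ := exists_ceil_sub_eq (t := t) (i := i) hn (by omega) (by omega)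
    obtain ⟨c, hc, hcj⟩ := exists_ceil_sub_eq (t := t) (i := j) hp (by omega) (by omega)
    have ht₁ : -m < t := by omega
    have ht₂ : t ≤ 0 := by omega
    exact ⟨t, b, c, ⟨by exact_mod_cast ht₁, by exact_mod_cast ht₂⟩, hb, hc, by rw [hbi, hcj]⟩

/-- The conic classes, partitioned according to which of `0`, `i`, `j` is the smallest. -/
lemma conicClasses_eq_coe {m n p : ℤ} (hm : 2 ≤ m) (hn : 2 ≤ n) (hp : 2 ≤ p) :
    conicClasses m n p =
      ((Finset.Ico 0 n ×ˢ Finset.Ico 0 p ∪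
        ((Finset.Ioo (-m) 0 ×ˢ Finset.Ico 0 p).image (fun x => (x.1, x.1 + x.2)) ∪
        (Finset.Ioo (-m) 0 ×ˢ Finset.Ioo 0 n).image (fun x => (x.1 + x.2, x.1))) :
          Finset (ℤ × ℤ)) : Set (ℤ × ℤ)) := by
  ext ⟨i, j⟩
  rw [mem_conicClasses_iff hm hn hp]
  simp only [Finset.mem_coe, Finset.mem_union, Finset.mem_product, Finset.mem_image,
    Finset.mem_Ico, Finset.mem_Ioo, Prod.exists, Prod.mk.injEq]
  constructor
  · intro h
    by_cases h₀ : 0 ≤ i ∧ 0 ≤ j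
    · left; omega
    · by_cases h₁ : i ≤ j
      · exact Or.inr (Or.inl ⟨i, j - i, by omega, rfl, by omega⟩)
      · exact Or.inr (Or.inr ⟨j, i - j, by omega, by omega, rfl⟩)
  · rintro (h | ⟨k, d, h, rfl, rfl⟩ | ⟨k, d, h, rfl, rfl⟩) <;> omega

theorem card_conicClasses (m n p : ℤ) (hm : 2 ≤ m) (hn : 2 ≤ n) (hp : 2 ≤ p) :
    (conicClasses m n p).Finite ∧
      ((conicClasses m n p).ncard : ℤ) = (m * n + m * p + n * p) - (m + n + p) + 1 := by
  rw [conicClasses_eq_coe hm hn hp]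
  refine ⟨Finset.finite_toSet _, ?_⟩
  rw [Set.ncard_coe_finset, Finset.card_union_of_disjoint, Finset.card_union_of_disjoint,
    Finset.card_image_of_injective, Finset.card_image_of_injective]
  · simp only [Finset.card_product, Int.card_Ico, Int.card_Ioo]
    push_cast
    rw [Int.toNat_of_nonneg (by omega), Int.toNat_of_nonneg (by omega),
      Int.toNat_of_nonneg (by omega), Int.toNat_of_nonneg (by omega)]
    ring
  · rintro ⟨a, b⟩ ⟨c, d⟩ h
    simp only [Prod.mk.injEq] at h ⊢
    omega
  · rintro ⟨a, b⟩ ⟨c, d⟩ h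
    simp only [Prod.mk.injEq] at h ⊢
    omega
  all_goals
    rw [Finset.disjoint_left]
    rintro ⟨i, j⟩
    simp only [Finset.mem_union, Finset.mem_product, Finset.mem_image,
      Finset.mem_Ico, Finset.mem_Ioo, Prod.exists, Prod.mk.injEq]
  · rintro ⟨k, d, h, rfl, rfl⟩ ⟨k', d', h', h₁, h₂⟩
    omega
  · rintro h (⟨k, d, h', rfl, rfl⟩ | ⟨k, d, h', rfl, rfl⟩) <;> omega
end

section
/- Let m, n, p ≥ 2 be integers. The cardinality of the set A = { (i,j) ∈ ℤ² : at least two of the conditions −(m−1) ≤ i ≤ n−1, −(m−1) ≤ j ≤ p−1, −(n−1) ≤ j−i ≤ p−1 hold } is strictly greater than the cardinality of the set B = { (⌈a−b⌉, ⌈a−c⌉) ∈ ℤ² : a, b, c ∈ ℝ, −m < a ≤ 0, −(n−1) < b ≤ 0, −(p−1) < c ≤ 0 }. (For the Segre product of three polynomial rings, the number of Cohen–Macaulay classes is strictly greater than the number of conic classes.) -/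
/-- Every conic class satisfies all three inequalities defining the Cohen–Macaulay classes. -/
theorem bounds_of_mem_conicClasses {m n p : ℤ} {q : ℤ × ℤ} (hq : q ∈ conicClasses m n p) :
    (-(m - 1) ≤ q.1 ∧ q.1 ≤ n - 1) ∧ (-(m - 1) ≤ q.2 ∧ q.2 ≤ p - 1) ∧
      (-(n - 1) ≤ q.2 - q.1 ∧ q.2 - q.1 ≤ p - 1) := by
  obtain ⟨a, b, c, ⟨ha, ha'⟩, ⟨hb, hb'⟩, ⟨hc, hc'⟩, rfl⟩ := hq
  have hi := Int.le_ceil (a - b)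
  have hi' := Int.ceil_lt_add_one (a - b)
  have hj := Int.le_ceil (a - c)
  have hj' := Int.ceil_lt_add_one (a - c)
  have h₁ : -m < ⌈a - b⌉ := by
    have : ((-m : ℤ) : ℝ) < (⌈a - b⌉ : ℝ) := by push_cast; linarith
    exact_mod_cast this
  have h₂ : ⌈a - b⌉ < n := by
    have : (⌈a - b⌉ : ℝ) < (n : ℝ) := by linarith
    exact_mod_cast this
  have h₃ : -m < ⌈a - c⌉ := by
    have : ((-m : ℤ) : ℝ) < (⌈a - c⌉ : ℝ) := by push_cast; linarith
    exact_mod_cast this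
  have h₄ : ⌈a - c⌉ < p := by
    have : (⌈a - c⌉ : ℝ) < (p : ℝ) := by linarith
    exact_mod_cast this
  have h₅ : -n < ⌈a - c⌉ - ⌈a - b⌉ := by
    have : ((-n : ℤ) : ℝ) < ((⌈a - c⌉ - ⌈a - b⌉ : ℤ) : ℝ) := by push_cast; linarith
    exact_mod_cast this
  have h₆ : ⌈a - c⌉ - ⌈a - b⌉ < p := by
    have : ((⌈a - c⌉ - ⌈a - b⌉ : ℤ) : ℝ) < (p : ℝ) := by push_cast; linarith
    exact_mod_cast this
  dsimp only
  omega

theorem finite_cohenMacaulayClasses (m n p : ℤ) : (cohenMacaulayClasses m n p).Finite := by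
  let r : ℤ := |m| + |n| + |p| + 2
  refine (Set.finite_Icc (-r, -r) (r, r)).subset fun q hq => ?_
  simp only [cohenMacaulayClasses, Set.mem_ofPred_eq] at hq
  simp only [Set.mem_Icc, Prod.le_def, r]
  have hm := abs_le.mp (le_refl |m|)
  have hn := abs_le.mp (le_refl |n|)
  have hp := abs_le.mp (le_refl |p|)
  omega

theorem conicClasses_ssubset_cohenMacaulayClasses {m n p : ℤ}
    (hm : 2 ≤ m) (hn : 2 ≤ n) (hp : 2 ≤ p) :
    conicClasses m n p ⊂ cohenMacaulayClasses m n p := by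
  refine Set.ssubset_iff_of_subset (fun q hq => ?_) |>.mpr ⟨(n - 1, -(m - 1)), ?_, fun h => ?_⟩
  · have h := bounds_of_mem_conicClasses hq
    exact Or.inl ⟨h.1, h.2.1⟩
  · left
    dsimp only
    omega
  · have h := bounds_of_mem_conicClasses h
    dsimp only at h
    omega

/-- For the Segre product of three polynomial rings the number of Cohen–Macaulay classes
is strictly greater than the number of conic classes. -/
theorem card_conicClasses_lt_card_cohenMacaulayClasses (m n p : ℤ)
    (hm : 2 ≤ m) (hn : 2 ≤ n) (hp : 2 ≤ p) :
    (cohenMacaulayClasses m n p).Finite ∧ (conicClasses m n p).Finite ∧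
      (conicClasses m n p).ncard < (cohenMacaulayClasses m n p).ncard := by
  have hfin := finite_cohenMacaulayClasses m n p
  have hlt := conicClasses_ssubset_cohenMacaulayClasses hm hn hp
  exact ⟨hfin, hfin.subset hlt.subset, Set.ncard_lt_ncard hlt hfin⟩
end

section
/- For every (i,j) ∈ ℤ², the R-module M_{(i,j)} is nonzero and finitely generated, and there exists a monomial w ∈ P such that multiplication by w maps M_{(i,j)} injectively into R; consequently M_{(i,j)} is isomorphic as an R-module to a nonzero ideal of R. -/
open MvPolynomial

set_option synthInstance.maxHeartbeats 1000000
set_option maxHeartbeats 1000000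

/-- Sum of the `X`-exponents of a monomial exponent vector. -/
def asum (m n p : ℕ) (σ : (Fin m ⊕ Fin n ⊕ Fin p) →₀ ℕ) : ℤ :=
  ∑ a : Fin m, (σ (Sum.inl a) : ℤ)

/-- Sum of the `Y`-exponents of a monomial exponent vector. -/
def bsum (m n p : ℕ) (σ : (Fin m ⊕ Fin n ⊕ Fin p) →₀ ℕ) : ℤ :=
  ∑ b : Fin n, (σ (Sum.inr (Sum.inl b)) : ℤ)

/-- Sum of the `Z`-exponents of a monomial exponent vector. -/
def csum (m n p : ℕ) (σ : (Fin m ⊕ Fin n ⊕ Fin p) →₀ ℕ) : ℤ :=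
  ∑ c : Fin p, (σ (Sum.inr (Sum.inr c)) : ℤ)

/-- The Segre product `R` of three polynomial rings: the `K`-subalgebra of
`P = K[X₁,…,X_m,Y₁,…,Y_n,Z₁,…,Z_p]` spanned by all monomials with `|α| = |β| = |γ|`. -/
noncomputable def segreRing (K : Type*) [Field K] (m n p : ℕ) :
    Subalgebra K (MvPolynomial (Fin m ⊕ Fin n ⊕ Fin p) K) :=
  Algebra.adjoin K
    {f | ∃ σ, asum m n p σ = bsum m n p σ ∧ asum m n p σ = csum m n p σ ∧
      f = monomial σ (1 : K)}

/-- The class module `M_{(i,j)}`: the subspace of `P` spanned by all monomials with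
`|α| = |β| + i` and `|α| = |γ| + j`, as a module over the Segre product `R`. -/
noncomputable def segreClassModule (K : Type*) [Field K] (m n p : ℕ) (i j : ℤ) :
    Submodule (segreRing K m n p) (MvPolynomial (Fin m ⊕ Fin n ⊕ Fin p) K) :=
  Submodule.span (segreRing K m n p)
    {f | ∃ σ, asum m n p σ = bsum m n p σ + i ∧ asum m n p σ = csum m n p σ + j ∧
      f = monomial σ (1 : K)}

section Auxiliary

variable {K : Type*} [Field K] {m n p : ℕ}

lemma asum_add (σ τ : (Fin m ⊕ Fin n ⊕ Fin p) →₀ ℕ) :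
    asum m n p (σ + τ) = asum m n p σ + asum m n p τ := by
  simp [asum, Finset.sum_add_distrib]

lemma bsum_add (σ τ : (Fin m ⊕ Fin n ⊕ Fin p) →₀ ℕ) :
    bsum m n p (σ + τ) = bsum m n p σ + bsum m n p τ := by
  simp [bsum, Finset.sum_add_distrib]

lemma csum_add (σ τ : (Fin m ⊕ Fin n ⊕ Fin p) →₀ ℕ) :
    csum m n p (σ + τ) = csum m n p σ + csum m n p τ := by
  simp [csum, Finset.sum_add_distrib]

/-- Any three natural numbers are the block degrees of some monomial. -/
lemma exists_exponent_of_blockDegrees (hm : 0 < m) (hn : 0 < n) (hp : 0 < p) (a b c : ℕ) :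
    ∃ σ : (Fin m ⊕ Fin n ⊕ Fin p) →₀ ℕ,
      asum m n p σ = a ∧ bsum m n p σ = b ∧ csum m n p σ = c := by
  refine ⟨Finsupp.single (Sum.inl ⟨0, hm⟩) a +
    (Finsupp.single (Sum.inr (Sum.inl ⟨0, hn⟩)) b +
      Finsupp.single (Sum.inr (Sum.inr ⟨0, hp⟩)) c), ?_, ?_, ?_⟩
  · simp [asum, Finsupp.single_apply]
  · simp [bsum, Finsupp.single_apply]
  · simp [csum, Finsupp.single_apply]

/-- The exponents of the monomials spanning `M_{(i,j)}`. -/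
def classExponents (m n p : ℕ) (i j : ℤ) : Set ((Fin m ⊕ Fin n ⊕ Fin p) →₀ ℕ) :=
  {σ | asum m n p σ = bsum m n p σ + i ∧ asum m n p σ = csum m n p σ + j}

lemma monomial_mem_segreRing {σ : (Fin m ⊕ Fin n ⊕ Fin p) →₀ ℕ}
    (hb : asum m n p σ = bsum m n p σ) (hc : asum m n p σ = csum m n p σ) :
    monomial σ (1 : K) ∈ segreRing K m n p :=
  Algebra.subset_adjoin ⟨σ, hb, hc, rfl⟩

lemma monomial_mem_segreClassModule {i j : ℤ} {σ : (Fin m ⊕ Fin n ⊕ Fin p) →₀ ℕ}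
    (hσ : σ ∈ classExponents m n p i j) :
    monomial σ (1 : K) ∈ segreClassModule K m n p i j :=
  Submodule.subset_span ⟨σ, hσ.1, hσ.2, rfl⟩

lemma classExponents_nonempty (hm : 0 < m) (hn : 0 < n) (hp : 0 < p) (i j : ℤ) :
    (classExponents m n p i j).Nonempty := by
  obtain ⟨σ, ha, hb, hc⟩ := exists_exponent_of_blockDegrees hm hn hp
    (i.natAbs + j.natAbs) (i.natAbs + j.natAbs - i).toNat (i.natAbs + j.natAbs - j).toNat
  exact ⟨σ, by constructor <;> omega⟩

lemma segreClassModule_ne_bot (hm : 0 < m) (hn : 0 < n) (hp : 0 < p) (i j : ℤ) :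
    segreClassModule K m n p i j ≠ ⊥ := by
  obtain ⟨σ, hσ⟩ := classExponents_nonempty hm hn hp i j
  exact (Submodule.ne_bot_iff _).2 ⟨_, monomial_mem_segreClassModule hσ, by simp⟩

/-- By Dickson's lemma there are finitely many minimal exponents, and the corresponding
monomials generate `M_{(i,j)}`. -/
lemma segreClassModule_fg (i j : ℤ) : (segreClassModule K m n p i j).FG := by
  set T := {σ | Minimal (· ∈ classExponents m n p i j) σ}
  have hT : T.Finite := WellQuasiOrderedLE.finite_of_isAntichain (setOfPred_minimal_antichain _)
  refine Submodule.fg_def.2 ⟨(fun σ => monomial σ (1 : K)) '' T, hT.image _, ?_⟩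
  apply le_antisymm
  · rw [Submodule.span_le]
    rintro _ ⟨σ, hσ, rfl⟩
    exact monomial_mem_segreClassModule hσ.prop
  · refine Submodule.span_le.2 ?_
    rintro _ ⟨σ, hb, hc, rfl⟩
    obtain ⟨μ, hμσ, hμ⟩ := exists_minimal_le_of_wellFoundedLT
      (· ∈ classExponents m n p i j) σ ⟨hb, hc⟩
    obtain ⟨ν, rfl⟩ := exists_add_of_le hμσ
    obtain ⟨hμb, hμc⟩ := hμ.prop
    rw [asum_add, bsum_add] at hb
    rw [asum_add, csum_add] at hc
    have hν : monomial ν (1 : K) ∈ segreRing K m n p :=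
      monomial_mem_segreRing (by linarith) (by linarith)
    have h := Submodule.smul_mem _ (⟨_, hν⟩ : segreRing K m n p)
      (Submodule.subset_span (R := segreRing K m n p)
        (Set.mem_image_of_mem (fun σ => monomial σ (1 : K)) (show μ ∈ T from hμ)))
    simpa [Subalgebra.smul_def, monomial_mul, add_comm] using h

lemma exists_monomial_mul_mem_segreRing (hm : 0 < m) (hn : 0 < n) (hp : 0 < p) (i j : ℤ) :
    ∃ τ : (Fin m ⊕ Fin n ⊕ Fin p) →₀ ℕ, ∀ f ∈ segreClassModule K m n p i j,
      monomial τ (1 : K) * f ∈ segreRing K m n p := by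
  obtain ⟨τ, hτb, hτc⟩ := classExponents_nonempty hm hn hp (-i) (-j)
  refine ⟨τ, fun f hf => ?_⟩
  induction hf using Submodule.span_induction with
  | mem x hx =>
    obtain ⟨σ, hb, hc, rfl⟩ := hx
    rw [monomial_mul, one_mul]
    apply monomial_mem_segreRing
    · rw [asum_add, bsum_add]; linarith
    · rw [asum_add, csum_add]; linarith
  | zero => simp
  | add x y _ _ hx hy => rw [mul_add]; exact add_mem hx hy
  | smul r x _ hx =>
    rw [Subalgebra.smul_def, smul_eq_mul, mul_left_comm]
    exact mul_mem r.2 hx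

/-- A nonzero submodule that some injective multiplication carries into the subalgebra `R`
is isomorphic to a nonzero ideal of `R`. -/
lemma exists_ideal_linearEquiv_of_mul_mem {A : Type*} [CommRing A] [Algebra K A]
    {R : Subalgebra K A} {M : Submodule R A} (hM : M ≠ ⊥) (w : A)
    (hw : ∀ f ∈ M, w * f ∈ R) (hinj : Function.Injective fun f : M => w * (f : A)) :
    ∃ I : Ideal R, I ≠ ⊥ ∧ Nonempty (M ≃ₗ[R] I) := by
  let φ : M →ₗ[R] R :=
    { toFun := fun f => ⟨w * f, hw f f.2⟩
      map_add' := fun f g => Subtype.ext (mul_add w (f : A) g)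
      map_smul' := fun r f => Subtype.ext (mul_left_comm w (r : A) f) }
  have hφ : Function.Injective φ := fun f g h => hinj (congrArg Subtype.val h)
  refine ⟨LinearMap.range φ, fun h => hM ?_, ⟨LinearEquiv.ofInjective φ hφ⟩⟩
  rw [LinearMap.range_eq_bot] at h
  refine (Submodule.eq_bot_iff _).2 fun x hx => ?_
  have hx0 : (⟨x, hx⟩ : M) = 0 := hφ (by rw [h]; rfl)
  exact congrArg Subtype.val hx0

end Auxiliary

/-- Each `M_{(i,j)}` is a nonzero finitely generated `R`-module, there is a monomial
`w ∈ P` such that multiplication by `w` maps `M_{(i,j)}` injectively into `R`, and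
consequently `M_{(i,j)}` is isomorphic as an `R`-module to a nonzero ideal of `R`. -/
theorem segreClassModule_isomorphic_to_ideal (K : Type*) [Field K] (m n p : ℕ)
    (hm : 2 ≤ m) (hn : 2 ≤ n) (hp : 2 ≤ p) (i j : ℤ) :
    segreClassModule K m n p i j ≠ ⊥ ∧
    (segreClassModule K m n p i j).FG ∧
    (∃ τ : (Fin m ⊕ Fin n ⊕ Fin p) →₀ ℕ,
      (∀ f ∈ segreClassModule K m n p i j,
        MvPolynomial.monomial τ (1 : K) * f ∈ segreRing K m n p) ∧
      Function.Injective (fun f : segreClassModule K m n p i j =>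
        MvPolynomial.monomial τ (1 : K) * (f : MvPolynomial (Fin m ⊕ Fin n ⊕ Fin p) K))) ∧
    (∃ I : Ideal (segreRing K m n p), I ≠ ⊥ ∧
      Nonempty ((segreClassModule K m n p i j) ≃ₗ[segreRing K m n p] I)) := by
  have hm : 0 < m := by omega
  have hn : 0 < n := by omega
  have hp : 0 < p := by omega
  have hne := segreClassModule_ne_bot (K := K) hm hn hp i j
  obtain ⟨τ, hτ⟩ := exists_monomial_mul_mem_segreRing (K := K) hm hn hp i j
  have hinj : Function.Injective (fun f : segreClassModule K m n p i j =>
      monomial τ (1 : K) * (f : MvPolynomial (Fin m ⊕ Fin n ⊕ Fin p) K)) :=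
    fun f g h => Subtype.ext (mul_left_cancel₀ (by simp) h)
  exact ⟨hne, segreClassModule_fg i j, ⟨τ, hτ, hinj⟩,
    exists_ideal_linearEquiv_of_mul_mem hne _ hτ hinj⟩
end

section
/- Let m, n ≥ 2 and let i be an integer with −(m−1) ≤ i ≤ n−1. Consider the formal power series H(s) = Σ_{t ≥ max(0,i)} C(t+m−1, m−1)·C(t−i+n−1, n−1)·s^t over ℤ (the Hilbert series of the Segre product R₁ # R₂(−i) of polynomial rings in m and n variables). Then there exists a polynomial Q ∈ ℤ[s] with (1−s)^{m+n−1}·H(s) = Q(s) as power series, Q(1) ≠ 0, and deg Q = (m+n−1) − max(m, n−i). (Equivalently, the a-invariant a(R₁ # R₂(−i)) equals −max(m, n−i).) -/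
/-- The Hilbert series of the Segre product `R₁ # R₂(-i)` of polynomial rings in `m`
and `n` variables: the power series over `ℤ` whose coefficient of `s^t` is
`C(t+m-1, m-1) * C(t-i+n-1, n-1)` for `t ≥ max(0, i)` and `0` otherwise. -/
noncomputable def segreShiftHilbertSeries (m n : ℕ) (i : ℤ) : PowerSeries ℤ :=
  PowerSeries.mk fun t : ℕ =>
    if max 0 i ≤ (t : ℤ) then
      ((t + m - 1).choose (m - 1) : ℤ) * (((t : ℤ) - i + n - 1).toNat.choose (n - 1) : ℤ)
    else 0

open Finset in
theorem sum_antidiagonal_antidiagonal_assoc {M : Type*} [AddCommMonoid M] (n : ℕ)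
    (f : ℕ → ℕ → ℕ → M) :
    ∑ x ∈ antidiagonal n, ∑ y ∈ antidiagonal x.1, f y.1 y.2 x.2 =
      ∑ x ∈ antidiagonal n, ∑ y ∈ antidiagonal x.2, f x.1 y.1 y.2 := by
  rw [sum_sigma', sum_sigma']
  refine sum_bij' (fun z _ => ⟨(z.2.1, z.2.2 + z.1.2), (z.2.2, z.1.2)⟩)
    (fun z _ => ⟨(z.1.1 + z.2.1, z.2.2), (z.1.1, z.2.1)⟩) ?_ ?_ ?_ ?_ ?_
  all_goals
    rintro ⟨⟨a, b⟩, ⟨c, d⟩⟩ h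
    simp only [mem_sigma, HasAntidiagonal.mem_antidiagonal] at h
    obtain ⟨rfl, h⟩ := h
    subst h
    simp [add_assoc]

open Finset in
theorem choose_add_add_eq_sum_antidiagonal (k N r : ℕ) :
    (N + k).choose (r + k) =
      ∑ x ∈ antidiagonal k, k.choose x.1 * N.choose (r + x.2) := by
  rw [add_comm N, Nat.add_choose_eq, Nat.sum_antidiagonal_eq_sum_range_succ_mk,
    Nat.sum_antidiagonal_eq_sum_range_succ_mk]
  symm
  refine (sum_congr rfl fun j hj => ?_).trans
    (sum_subset (range_mono (by lia : k + 1 ≤ r + k + 1)) fun j _ hj => ?_)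
  · rw [mem_range] at hj
    rw [show r + k - j = r + (k - j) by lia]
  · rw [mem_range] at hj
    rw [Nat.choose_eq_zero_of_lt (by lia), zero_mul]

theorem choose_add_mul_choose_add (a v t : ℕ) :
    (t + a).choose (a + v) * (a + v).choose v = (t + a).choose a * t.choose v := by
  have h := Nat.choose_mul (n := t + a) (k := a + v) (s := a) (Nat.le_add_right a v)
  rwa [Nat.add_sub_cancel, Nat.add_sub_cancel_left, Nat.choose_symm_add] at h

open Finset in
/-- A form of Surányi's identity. -/
theorem sum_antidiagonal_choose_mul_choose_mul_choose {a b p q : ℕ} (h : p + q = a + b) (t : ℕ) :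
    ∑ x ∈ antidiagonal b, p.choose x.1 * q.choose x.2 * (t + a + x.1).choose (a + b) =
      (t + a).choose a * (t + p).choose b := by
  calc
    _ = ∑ x ∈ antidiagonal b, ∑ y ∈ antidiagonal x.1, p.choose (y.1 + y.2) *
          (y.1 + y.2).choose y.1 * q.choose x.2 * (t + a).choose (a + (y.2 + x.2)) := by
      refine sum_congr rfl fun x hx => ?_
      rw [HasAntidiagonal.mem_antidiagonal] at hx
      rw [show a + b = a + x.2 + x.1 by lia, choose_add_add_eq_sum_antidiagonal, mul_sum]
      refine sum_congr rfl fun y hy => ?_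
      rw [HasAntidiagonal.mem_antidiagonal] at hy
      rw [hy, show a + x.2 + y.2 = a + (y.2 + x.2) by lia]
      ring
    _ = ∑ x ∈ antidiagonal b, ∑ y ∈ antidiagonal x.2, p.choose (x.1 + y.1) *
          (x.1 + y.1).choose x.1 * q.choose y.2 * (t + a).choose (a + (y.1 + y.2)) :=
      sum_antidiagonal_antidiagonal_assoc b fun u w j =>
        p.choose (u + w) * (u + w).choose u * q.choose j * (t + a).choose (a + (w + j))
    _ = ∑ x ∈ antidiagonal b, (t + a).choose a * (p.choose x.1 * t.choose x.2) := by
      refine sum_congr rfl fun x hx => ?_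
      rw [HasAntidiagonal.mem_antidiagonal] at hx
      rcases lt_or_ge p x.1 with hp | hp
      · rw [Nat.choose_eq_zero_of_lt hp]
        simp only [zero_mul, mul_zero]
        refine sum_eq_zero fun y _ => ?_
        rw [Nat.choose_eq_zero_of_lt (by lia : p < x.1 + y.1)]
        simp
      · rw [mul_left_comm, ← choose_add_mul_choose_add, show a + x.2 = p - x.1 + q by lia,
          Nat.add_choose_eq (p - x.1) q, ← show a + x.2 = p - x.1 + q by lia, mul_sum, mul_sum]
        refine sum_congr rfl fun y hy => ?_
        rw [HasAntidiagonal.mem_antidiagonal] at hy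
        rw [Nat.choose_mul (Nat.le_add_right x.1 y.1), Nat.add_sub_cancel_left, hy]
        ring
    _ = _ := by rw [← mul_sum, ← Nat.add_choose_eq, add_comm p t]

/-- The polynomial `∑ j, C(p, b - j) * C(q, j) * X ^ j`. For `p = b - i` and `q = a + i` it is the
numerator of the Hilbert series of `R₁ # R₂(-i)` in `a + 1` and `b + 1` variables. -/
noncomputable def segreShiftNumerator (p q b : ℕ) : Polynomial ℤ :=
  ∑ x ∈ Finset.HasAntidiagonal.antidiagonal b,
    Polynomial.monomial x.2 ((p.choose x.1 * q.choose x.2 : ℕ) : ℤ)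

theorem segreShiftNumerator_eval_one (p q b : ℕ) :
    (segreShiftNumerator p q b).eval 1 = (p + q).choose b := by
  simp [segreShiftNumerator, Polynomial.eval_finsetSum, Nat.add_choose_eq]

theorem natDegree_segreShiftNumerator {p q b : ℕ} (hbp : b ≤ p + q) :
    (segreShiftNumerator p q b).natDegree = min b q := by
  refine Polynomial.natDegree_eq_of_le_of_coeff_ne_zero
    (Polynomial.natDegree_sum_le_of_forall_le _ _ fun x hx => ?_) ?_
  · rw [Finset.HasAntidiagonal.mem_antidiagonal] at hx
    rcases lt_or_ge q x.2 with hq | hq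
    · simp [Nat.choose_eq_zero_of_lt hq]
    · exact (Polynomial.natDegree_monomial_le _).trans (le_min (by lia) hq)
  · rw [segreShiftNumerator, Polynomial.finsetSum_coeff,
      Finset.sum_eq_single_of_mem (b - min b q, min b q) (by simp)]
    · rw [Polynomial.coeff_monomial_same, Nat.cast_ne_zero]
      exact (Nat.mul_pos (Nat.choose_pos (by lia)) (Nat.choose_pos (min_le_right b q))).ne'
    · intro x hx hne
      rw [Finset.HasAntidiagonal.mem_antidiagonal] at hx
      refine Polynomial.coeff_monomial_of_ne _ fun h => hne ?_
      ext <;> simp only <;> lia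

theorem segreShiftNumerator_mul_mk_choose {a b p q : ℕ} (h : p + q = a + b) :
    (segreShiftNumerator p q b : PowerSeries ℤ) *
        PowerSeries.mk (fun t => ((a + b + t).choose (a + b) : ℤ)) =
      PowerSeries.mk fun t => ((t + a).choose a * (t + p).choose b : ℤ) := by
  ext t
  rw [PowerSeries.coeff_mk, segreShiftNumerator, ← Polynomial.coeToPowerSeries.ringHom_apply,
    map_sum, Finset.sum_mul, map_sum]
  rw [← Nat.cast_mul, ← sum_antidiagonal_choose_mul_choose_mul_choose h, Nat.cast_sum]
  refine Finset.sum_congr rfl fun x hx => ?_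
  rw [Finset.HasAntidiagonal.mem_antidiagonal] at hx
  rw [Polynomial.coeToPowerSeries.ringHom_apply, ← Polynomial.C_mul_X_pow_eq_monomial,
    Polynomial.coe_mul, Polynomial.coe_C, Polynomial.coe_pow, Polynomial.coe_X,
    mul_assoc (PowerSeries.C _), PowerSeries.coeff_C_mul, PowerSeries.coeff_X_pow_mul']
  split_ifs with hxt
  · rw [PowerSeries.coeff_mk, show a + b + (t - x.2) = t + a + x.1 by lia]
    push_cast
    ring
  · rw [Nat.choose_eq_zero_of_lt (by lia : t + a + x.1 < a + b)]
    simp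

theorem segreShiftHilbertSeries_eq_mk {a b p : ℕ} {i : ℤ} (hp : (p : ℤ) = b - i) :
    segreShiftHilbertSeries (a + 1) (b + 1) i =
      PowerSeries.mk fun t => ((t + a).choose a * (t + p).choose b : ℤ) := by
  ext t
  rw [segreShiftHilbertSeries, PowerSeries.coeff_mk, PowerSeries.coeff_mk]
  split_ifs with ht
  · rw [show ((t : ℤ) - i + (b + 1 : ℕ) - 1).toNat = t + p by lia]
    rfl
  · rw [Nat.choose_eq_zero_of_lt (by lia : t + p < b)]
    simp

/-- For `-(m-1) ≤ i ≤ n-1` the Hilbert series `H` of `R₁ # R₂(-i)` satisfies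
`(1-s)^(m+n-1) * H = Q` for a polynomial `Q ∈ ℤ[s]` with `Q(1) ≠ 0` and
`deg Q = (m+n-1) - max(m, n-i)`; equivalently the `a`-invariant of `R₁ # R₂(-i)`
is `-max(m, n-i)`. -/
theorem aInvariant_segreShift (m n : ℕ) (hm : 2 ≤ m) (hn : 2 ≤ n) (i : ℤ)
    (hi₁ : -(m - 1 : ℤ) ≤ i) (hi₂ : i ≤ (n : ℤ) - 1) :
    ∃ Q : Polynomial ℤ,
      (1 - PowerSeries.X : PowerSeries ℤ) ^ (m + n - 1) * segreShiftHilbertSeries m n i =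
        (Q : PowerSeries ℤ) ∧
      Q.eval 1 ≠ 0 ∧
      (Q.natDegree : ℤ) = (m + n - 1 : ℤ) - max (m : ℤ) ((n : ℤ) - i) := by
  obtain ⟨a, rfl⟩ : ∃ a, m = a + 1 := ⟨m - 1, by lia⟩
  obtain ⟨b, rfl⟩ : ∃ b, n = b + 1 := ⟨n - 1, by lia⟩
  obtain ⟨p, hp⟩ : ∃ p : ℕ, (p : ℤ) = b - i := ⟨(b - i).toNat, by lia⟩
  obtain ⟨q, hq⟩ : ∃ q : ℕ, (q : ℤ) = a + i := ⟨(a + i).toNat, by lia⟩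
  have hpq : p + q = a + b := by lia
  refine ⟨segreShiftNumerator p q b, ?_, ?_, ?_⟩
  · rw [segreShiftHilbertSeries_eq_mk hp, ← segreShiftNumerator_mul_mk_choose hpq,
      show a + 1 + (b + 1) - 1 = a + b + 1 by lia, mul_left_comm, mul_comm (_ ^ _),
      PowerSeries.mk_add_choose_mul_one_sub_pow_eq_one, mul_one]
  · rw [segreShiftNumerator_eval_one, Nat.cast_ne_zero]
    exact (Nat.choose_pos (by lia)).ne'
  · rw [natDegree_segreShiftNumerator (by lia)]
    lia
end

section
/- Let (i,j) ∈ ℤ². There exists a sequence of m+n+p−2 elements of the irrelevant maximal ideal 𝔪 of R (the ideal of R spanned by all monomials of positive degree) that is a regular sequence on the R-module M_{(i,j)} if and only if at least two of the following three conditions hold: (a) −(m−1) ≤ i ≤ n−1; (b) −(m−1) ≤ j ≤ p−1; (c) −(n−1) ≤ j−i ≤ p−1. (Since the Krull dimension of R is m+n+p−2, this says exactly that M_{(i,j)} is a Cohen–Macaulay R-module if and only if at least two of (a),(b),(c) hold.) -/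
open MvPolynomial

set_option synthInstance.maxHeartbeats 1000000
set_option maxHeartbeats 1000000

/-- The irrelevant maximal ideal `𝔪` of the Segre product `R`: the ideal of `R`
spanned by all monomials of positive degree. -/
noncomputable def segreIrrelevantIdeal (K : Type*) [Field K] (m n p : ℕ) :
    Ideal (segreRing K m n p) :=
  Ideal.span {r | ∃ σ : (Fin m ⊕ Fin n ⊕ Fin p) →₀ ℕ, σ ≠ 0 ∧
    (r : MvPolynomial (Fin m ⊕ Fin n ⊕ Fin p) K) = MvPolynomial.monomial σ (1 : K)}

section ExtDepth

open CategoryTheory Abelian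
open scoped Pointwise

universe u

variable {R : Type u} [CommRing R]

/-- `ExtDepthGE I r M` says that `Ext^k(R/I, M) = 0` for all `k < r`, i.e. that the `I`-depth of
`M` is at least `r`. -/
def ExtDepthGE (I : Ideal R) (r : ℕ) (M : Type u) [AddCommGroup M] [Module R M] : Prop :=
  ∀ k < r, Subsingleton (Ext (ModuleCat.of R (R ⧸ I)) (ModuleCat.of R M) k)

variable {I : Ideal R} {r : ℕ}
variable {U V W : Type u} [AddCommGroup U] [AddCommGroup V] [AddCommGroup W]
variable [Module R U] [Module R V] [Module R W]

namespace ExtDepthGE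

lemma mono {s : ℕ} (h : ExtDepthGE I r V) (hs : s ≤ r) : ExtDepthGE I s V :=
  fun k hk => h k (hk.trans_le hs)

lemma of_subsingleton [Subsingleton V] : ExtDepthGE I r V := by
  intro k _
  have hV : Limits.IsZero (ModuleCat.of R V) := ModuleCat.isZero_of_subsingleton _
  refine subsingleton_of_forall_eq 0 fun x => ?_
  rw [← x.comp_mk₀_id, hV.eq_of_src (𝟙 _) 0, Ext.mk₀_zero, Ext.comp_zero]

private lemma shortExact {f : U →ₗ[R] V} {g : V →ₗ[R] W} (hf : Function.Injective f)
    (hfg : Function.Exact f g) (hg : Function.Surjective g) :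
    (ModuleCat.shortComplexOfCompEqZero f g hfg.linearMap_comp_eq_zero).ShortExact where
  exact := ModuleCat.shortComplex_exact _ hfg
  mono_f := (ModuleCat.mono_iff_injective _).2 hf
  epi_g := (ModuleCat.epi_iff_surjective _).2 hg

section ShortExact

variable {f : U →ₗ[R] V} {g : V →ₗ[R] W} (hf : Function.Injective f)
  (hfg : Function.Exact f g) (hg : Function.Surjective g)

include hf hfg hg

lemma middle (hU : ExtDepthGE I r U) (hW : ExtDepthGE I r W) : ExtDepthGE I r V := by
  intro k hk
  have hS := shortExact hf hfg hg
  refine subsingleton_of_forall_eq 0 fun x => ?_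
  obtain ⟨y, rfl⟩ := Ext.covariant_sequence_exact₂ _ hS x ((hW k hk).elim _ _)
  have : y = 0 := (hU k hk).elim _ _
  rw [this, Ext.zero_comp]

lemma right (hU : ExtDepthGE I (r + 1) U) (hV : ExtDepthGE I r V) : ExtDepthGE I r W := by
  intro k hk
  have hS := shortExact hf hfg hg
  refine subsingleton_of_forall_eq 0 fun x => ?_
  obtain ⟨y, rfl⟩ := Ext.covariant_sequence_exact₃ _ hS x (n₁ := k + 1) rfl
    ((hU (k + 1) (by omega)).elim _ _)
  have : y = 0 := (hV k hk).elim _ _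
  rw [this, Ext.zero_comp]

lemma eq_zero_of_comp_eq_zero (hW : ExtDepthGE I r W) {k : ℕ} (hk : k < r + 1)
    (x : Ext (ModuleCat.of R (R ⧸ I)) (ModuleCat.of R U) k)
    (hx : x.comp (Ext.mk₀ (ModuleCat.ofHom f)) (add_zero k) = 0) : x = 0 := by
  have hS := shortExact hf hfg hg
  cases k with
  | zero =>
    have : Mono (ModuleCat.ofHom f) := (ModuleCat.mono_iff_injective _).2 hf
    exact Ext.postcomp_mk₀_injective_of_mono _ (ModuleCat.ofHom f) (by simpa using hx)
  | succ k =>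
    obtain ⟨y, rfl⟩ := Ext.covariant_sequence_exact₁ _ hS x hx (n₀ := k) rfl
    have : y = 0 := (hW k (by omega)).elim _ _
    rw [this, Ext.zero_comp]

end ShortExact

lemma comp_mk₀_smul_eq_zero {w : R} (hw : w ∈ I) {k : ℕ}
    (x : Ext (ModuleCat.of R (R ⧸ I)) (ModuleCat.of R V) k) {f : V →ₗ[R] V}
    (hf : ∀ v, f v = w • v) : x.comp (Ext.mk₀ (ModuleCat.ofHom f)) (add_zero k) = 0 := by
  have h1 : ModuleCat.ofHom f = w • 𝟙 (ModuleCat.of R V) := by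
    ext v; exact hf v
  have h2 : w ∈ Module.annihilator R (R ⧸ I) := by rwa [Ideal.annihilator_quotient]
  rw [h1]
  simpa using ConcreteCategory.congr_hom
    (Ext.postcomp_smul_id_eq_zero_of_mem_annihilator (M := ModuleCat.of R V) h2 k) x

/-- If multiplication by `w ∈ I` on `V` factors as a composition of three injections whose
cokernels have depth at least `r`, then `V` has depth at least `r + 1`. -/
lemma succ_of_factorization {V₁ V₂ W₁ W₂ W₃ : Type u} [AddCommGroup V₁] [AddCommGroup V₂]
    [AddCommGroup W₁] [AddCommGroup W₂] [AddCommGroup W₃] [Module R V₁] [Module R V₂]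
    [Module R W₁] [Module R W₂] [Module R W₃] {w : R} (hw : w ∈ I)
    {f₁ : V₁ →ₗ[R] V} {g₁ : V →ₗ[R] W₁} {f₂ : V₂ →ₗ[R] V₁} {g₂ : V₁ →ₗ[R] W₂}
    {f₃ : V →ₗ[R] V₂} {g₃ : V₂ →ₗ[R] W₃}
    (hf₁ : Function.Injective f₁) (hfg₁ : Function.Exact f₁ g₁) (hg₁ : Function.Surjective g₁)
    (hf₂ : Function.Injective f₂) (hfg₂ : Function.Exact f₂ g₂) (hg₂ : Function.Surjective g₂)
    (hf₃ : Function.Injective f₃) (hfg₃ : Function.Exact f₃ g₃) (hg₃ : Function.Surjective g₃)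
    (hW₁ : ExtDepthGE I r W₁) (hW₂ : ExtDepthGE I r W₂) (hW₃ : ExtDepthGE I r W₃)
    (h : ∀ v, f₁ (f₂ (f₃ v)) = w • v) : ExtDepthGE I (r + 1) V := by
  intro k hk
  refine subsingleton_of_forall_eq 0 fun x => ?_
  refine eq_zero_of_comp_eq_zero hf₃ hfg₃ hg₃ hW₃ hk _ ?_
  refine eq_zero_of_comp_eq_zero hf₂ hfg₂ hg₂ hW₂ hk _ ?_
  refine eq_zero_of_comp_eq_zero hf₁ hfg₁ hg₁ hW₁ hk _ ?_
  rw [Ext.comp_assoc_of_third_deg_zero, Ext.comp_assoc_of_third_deg_zero,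
    Ext.mk₀_comp_mk₀, Ext.mk₀_comp_mk₀, ← ModuleCat.ofHom_comp, ← ModuleCat.ofHom_comp]
  exact comp_mk₀_smul_eq_zero hw x h

lemma one_iff : ExtDepthGE I 1 V ↔ Subsingleton ((R ⧸ I) →ₗ[R] V) := by
  have e : Ext (ModuleCat.of R (R ⧸ I)) (ModuleCat.of R V) 0 ≃ ((R ⧸ I) →ₗ[R] V) :=
    Ext.homEquiv₀.trans ModuleCat.homEquiv
  simp only [ExtDepthGE, Nat.lt_one_iff, forall_eq]
  exact e.subsingleton_congr

lemma not_one_of_smul_eq_zero {v : V} (hv : v ≠ 0) (h : ∀ x ∈ I, x • v = 0) :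
    ¬ ExtDepthGE I 1 V := by
  rw [one_iff]
  intro hsub
  have h0 : Submodule.liftQ I (LinearMap.toSpanSingleton R V v) (fun x hx => by simpa using h x hx)
    = 0 := Subsingleton.elim _ _
  have h1 := congrArg (fun f => f (Submodule.Quotient.mk (1 : R))) h0
  rw [Submodule.liftQ_apply] at h1
  exact hv (by simpa using h1)

lemma quotSMulTop {x : R} (hx : IsSMulRegular V x) (h : ExtDepthGE I (r + 1) V) :
    ExtDepthGE I r (QuotSMulTop x V) :=
  right (f := LinearMap.lsmul R V x) (g := (x • (⊤ : Submodule R V)).mkQ) hx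
    (LinearMap.exact_lsmul_mkQ_smul_top V x) (Submodule.mkQ_surjective _) h (h.mono (by omega))

lemma of_quotSMulTop {x : R} (hxI : x ∈ I) (hx : IsSMulRegular V x)
    (h : ExtDepthGE I r (QuotSMulTop x V)) : ExtDepthGE I (r + 1) V := by
  intro k hk
  refine subsingleton_of_forall_eq 0 fun y => ?_
  exact eq_zero_of_comp_eq_zero (f := LinearMap.lsmul R V x)
    (g := (x • (⊤ : Submodule R V)).mkQ) hx
    (LinearMap.exact_lsmul_mkQ_smul_top V x) (Submodule.mkQ_surjective _) h hk y
    (comp_mk₀_smul_eq_zero hxI y fun _ => rfl)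

lemma of_isWeaklyRegular (xs : List R) (hI : ∀ x ∈ xs, x ∈ I) (V : Type u) [AddCommGroup V]
    [Module R V] (h : RingTheory.Sequence.IsWeaklyRegular V xs) :
    ExtDepthGE I xs.length V := by
  induction xs generalizing V with
  | nil => intro k hk; simp at hk
  | cons x xs ih =>
    rw [RingTheory.Sequence.isWeaklyRegular_cons_iff] at h
    exact of_quotSMulTop (hI x (by simp)) h.1
      (ih (fun y hy => hI y (List.mem_cons_of_mem _ hy)) _ h.2)

lemma exists_isWeaklyRegular [IsNoetherianRing R] (r : ℕ) (V : Type u) [AddCommGroup V]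
    [Module R V] [Module.Finite R V] (h : ExtDepthGE I r V) :
    ∃ xs : List R, xs.length = r ∧ (∀ x ∈ xs, x ∈ I) ∧
      RingTheory.Sequence.IsWeaklyRegular V xs := by
  induction r generalizing V with
  | zero => exact ⟨[], rfl, by simp, .nil R V⟩
  | succ r ih =>
    obtain ⟨x, hxI, hx⟩ := IsSMulRegular.subsingleton_linearMap_iff.1
      (one_iff.1 (h.mono (by omega : 1 ≤ r + 1)))
    rw [Ideal.annihilator_quotient] at hxI
    obtain ⟨xs, rfl, hxs, hreg⟩ := ih _ (h.quotSMulTop hx)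
    refine ⟨x :: xs, rfl, by simpa using ⟨hxI, hxs⟩, ?_⟩
    rw [RingTheory.Sequence.isWeaklyRegular_cons_iff]
    exact ⟨hx, hreg⟩

end ExtDepthGE

end ExtDepth

section MonomialModules

universe u

variable {K : Type u} [Field K] {V : Type} [DecidableEq V]

/-- The endomorphism of the polynomial ring killing the variables outside `T`. -/
noncomputable def killOutside (T : Finset V) : MvPolynomial V K →ₐ[K] MvPolynomial V K :=
  aeval fun v => if v ∈ T then X v else 0

lemma coeff_killOutside (T : Finset V) (f : MvPolynomial V K) (σ : V →₀ ℕ) :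
    coeff σ (killOutside T f) = if σ.support ⊆ T then coeff σ f else 0 := by
  induction f using MvPolynomial.induction_on' with
  | add p q hp hq => rw [map_add, coeff_add, hp, hq]; split_ifs <;> simp
  | monomial τ c =>
    have h : killOutside T (monomial τ c) = if τ.support ⊆ T then monomial τ c else 0 := by
      rw [killOutside, aeval_monomial, algebraMap_eq]
      split_ifs with hτ
      · rw [monomial_eq]
        congr 1
        exact Finsupp.prod_congr fun v hv => by rw [if_pos (hτ hv)]
      · obtain ⟨v, hv, hvT⟩ := Finset.not_subset.1 hτ
        rw [Finsupp.prod, Finset.prod_eq_zero hv, mul_zero]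
        rw [if_neg hvT, zero_pow (Finsupp.mem_support_iff.1 hv)]
    rw [h]
    by_cases hστ : τ = σ
    · subst hστ; split_ifs <;> simp
    · split_ifs <;> simp [coeff_monomial, hστ]

lemma killOutside_eq_self {T : Finset V} {f : MvPolynomial V K}
    (h : ∀ σ, coeff σ f ≠ 0 → σ.support ⊆ T) : killOutside T f = f := by
  ext σ
  rw [coeff_killOutside]
  split_ifs with hσ
  · rfl
  · by_contra h0
    exact hσ (h σ (Ne.symm h0))

lemma killOutside_killOutside {S T : Finset V} (h : S ⊆ T) (f : MvPolynomial V K) :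
    killOutside S (killOutside T f) = killOutside S f := by
  ext σ
  simp only [coeff_killOutside]
  split_ifs with h1 h2
  · rfl
  · exact absurd (h1.trans h) h2
  · rfl

lemma exists_coeff_ne_zero_of_mul {f g : MvPolynomial V K} {σ : V →₀ ℕ}
    (h : coeff σ (f * g) ≠ 0) :
    ∃ τ ρ, τ + ρ = σ ∧ coeff τ f ≠ 0 ∧ coeff ρ g ≠ 0 := by
  rw [coeff_mul] at h
  obtain ⟨⟨τ, ρ⟩, hx, hne⟩ := Finset.exists_ne_zero_of_sum_ne_zero h
  exact ⟨τ, ρ, Finset.HasAntidiagonal.mem_antidiagonal.1 hx,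
    left_ne_zero_of_mul hne, right_ne_zero_of_mul hne⟩

variable [Fintype V] (l : V → Fin 3)

/-- The degree of a monomial in the variables carrying the letter `s`. -/
def letterDegree (s : Fin 3) (σ : V →₀ ℕ) : ℤ := ∑ v, if l v = s then (σ v : ℤ) else 0

omit [DecidableEq V] in
lemma letterDegree_add (s : Fin 3) (σ τ : V →₀ ℕ) :
    letterDegree l s (σ + τ) = letterDegree l s σ + letterDegree l s τ := by
  rw [letterDegree, letterDegree, letterDegree, ← Finset.sum_add_distrib]
  refine Finset.sum_congr rfl fun v _ => ?_
  split_ifs <;> simp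

omit [DecidableEq V] in
lemma letterDegree_nonneg (s : Fin 3) (σ : V →₀ ℕ) : 0 ≤ letterDegree l s σ :=
  Finset.sum_nonneg fun v _ => by split_ifs <;> simp

omit [DecidableEq V] in
lemma letterDegree_single (s : Fin 3) (v : V) (k : ℕ) :
    letterDegree l s (Finsupp.single v k) = if l v = s then (k : ℤ) else 0 := by
  rw [letterDegree, Finset.sum_eq_single v]
  · simp
  · intro w _ hw
    simp [Finsupp.single_eq_of_ne hw]
  · simp

omit [DecidableEq V] in
lemma letterDegree_eq_zero_iff (s : Fin 3) (σ : V →₀ ℕ) :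
    letterDegree l s σ = 0 ↔ ∀ v, l v = s → σ v = 0 := by
  rw [letterDegree, Finset.sum_eq_zero_iff_of_nonneg fun v _ => by split_ifs <;> simp]
  simp

/-- Monomials whose letter degrees are `t - e 0`, `t - e 1`, `t - e 2` for a common `t`. -/
def IsDiagonal (e : Fin 3 → ℤ) (σ : V →₀ ℕ) : Prop :=
  ∃ t, ∀ s, letterDegree l s σ = t - e s

variable {l}

omit [DecidableEq V] in
lemma IsDiagonal.add {e : Fin 3 → ℤ} {σ τ : V →₀ ℕ} (hσ : IsDiagonal l 0 σ)
    (hτ : IsDiagonal l e τ) : IsDiagonal l e (σ + τ) := by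
  obtain ⟨a, ha⟩ := hσ
  obtain ⟨b, hb⟩ := hτ
  refine ⟨a + b, fun s => ?_⟩
  rw [letterDegree_add, ha, hb, Pi.zero_apply]
  ring

omit [DecidableEq V] in
lemma IsDiagonal.of_add {e : Fin 3 → ℤ} {σ τ : V →₀ ℕ} (h : IsDiagonal l e (σ + τ))
    (hτ : IsDiagonal l e τ) : IsDiagonal l 0 σ := by
  obtain ⟨a, ha⟩ := h
  obtain ⟨b, hb⟩ := hτ
  refine ⟨a - b, fun s => ?_⟩
  have := ha s
  rw [letterDegree_add, hb] at this
  rw [Pi.zero_apply]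
  linarith

omit [DecidableEq V] in
lemma IsDiagonal.add_single_iff {e e' : Fin 3 → ℤ} {v : V} {k : ℤ}
    (h : ∀ s, e' s = e s + (if l v = s then 1 else 0) + k) (σ : V →₀ ℕ) :
    IsDiagonal l e (Finsupp.single v 1 + σ) ↔ IsDiagonal l e' σ := by
  constructor
  · rintro ⟨t, ht⟩
    refine ⟨t + k, fun s => ?_⟩
    have := ht s
    rw [letterDegree_add, letterDegree_single] at this
    rw [h]
    push_cast at this
    linarith
  · rintro ⟨t, ht⟩
    refine ⟨t - k, fun s => ?_⟩
    rw [letterDegree_add, letterDegree_single, ht, h]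
    push_cast
    ring

variable {R : Type u} [CommRing R]

/-- The polynomial ring, regarded as an `R`-module through `ψ` followed by `killOutside T`. -/
def Restricted (_ψ : R →+* MvPolynomial V K) (_T : Finset V) : Type u := MvPolynomial V K

noncomputable instance (ψ : R →+* MvPolynomial V K) (T : Finset V) :
    AddCommGroup (Restricted ψ T) :=
  inferInstanceAs (AddCommGroup (MvPolynomial V K))

noncomputable instance (ψ : R →+* MvPolynomial V K) (T : Finset V) : Module R (Restricted ψ T) :=
  Module.compHom (MvPolynomial V K) ((killOutside T).toRingHom.comp ψ)

/-- The `R`-module of polynomials in the variables of `T` all of whose monomials are diagonal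
with shift `e`. -/
def diagonalModule {ψ : R →+* MvPolynomial V K} (hψ : ∀ r σ, coeff σ (ψ r) ≠ 0 → IsDiagonal l 0 σ)
    (T : Finset V) (e : Fin 3 → ℤ) : Submodule R (Restricted ψ T) where
  carrier := {f : MvPolynomial V K | ∀ σ, coeff σ f ≠ 0 → σ.support ⊆ T ∧ IsDiagonal l e σ}
  add_mem' {f g} hf hg σ h := by
    by_cases h1 : coeff σ (f : MvPolynomial V K) = 0
    · refine hg σ fun h2 => h ?_
      exact (coeff_add σ _ _).trans (by rw [h1, h2, add_zero])
    · exact hf σ h1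
  zero_mem' σ h := absurd (coeff_zero σ) h
  smul_mem' r f hf σ h := by
    obtain ⟨τ, ρ, rfl, h1, h2⟩ := exists_coeff_ne_zero_of_mul
      (f := killOutside T (ψ r)) (g := f) h
    rw [coeff_killOutside] at h1
    have hτ : τ.support ⊆ T := by
      by_contra h0
      simp [h0] at h1
    rw [if_pos hτ] at h1
    exact ⟨Finsupp.support_add.trans (Finset.union_subset hτ (hf ρ h2).1),
      (hψ r τ h1).add (hf ρ h2).2⟩

variable {ψ : R →+* MvPolynomial V K} (hψ : ∀ r σ, coeff σ (ψ r) ≠ 0 → IsDiagonal l 0 σ)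

/-- The polynomial underlying an element of a diagonal module. -/
def diagonalPoly {T : Finset V} {e : Fin 3 → ℤ} (f : diagonalModule hψ T e) :
    MvPolynomial V K := f.1

lemma diagonalPoly_smul {T : Finset V} {e : Fin 3 → ℤ} (r : R) (f : diagonalModule hψ T e) :
    diagonalPoly hψ (r • f) = killOutside T (ψ r) * diagonalPoly hψ f := rfl

lemma diagonalPoly_injective {T : Finset V} {e : Fin 3 → ℤ} {f g : diagonalModule hψ T e}
    (h : diagonalPoly hψ f = diagonalPoly hψ g) : f = g := Subtype.ext h

/-- Multiplication by a variable of `T`, between diagonal modules. -/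
noncomputable def mulVar {T : Finset V} {v : V} (hv : v ∈ T) {e e' : Fin 3 → ℤ} {k : ℤ}
    (h : ∀ s, e' s = e s + (if l v = s then 1 else 0) + k) :
    diagonalModule hψ T e' →ₗ[R] diagonalModule hψ T e where
  toFun f := ⟨(X v * diagonalPoly hψ f : MvPolynomial V K), by
    intro σ hσ
    obtain ⟨τ, ρ, rfl, h1, h2⟩ := exists_coeff_ne_zero_of_mul hσ
    have hτ : τ = Finsupp.single v 1 := by
      by_contra h0
      rw [coeff_X, if_neg (Ne.symm h0)] at h1
      exact h1 rfl
    subst hτ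
    refine ⟨Finsupp.support_add.trans (Finset.union_subset ?_ (f.2 ρ h2).1),
      (IsDiagonal.add_single_iff h ρ).2 (f.2 ρ h2).2⟩
    exact Finsupp.support_single_subset.trans (by simpa using hv)⟩
  map_add' f g := Subtype.ext (mul_add (X v : MvPolynomial V K) _ _)
  map_smul' r f := Subtype.ext (mul_left_comm (X v : MvPolynomial V K) _ _)

/-- Setting a variable to zero, between diagonal modules. -/
noncomputable def killVar (T : Finset V) (v : V) (e : Fin 3 → ℤ) :
    diagonalModule hψ T e →ₗ[R] diagonalModule hψ (T.erase v) e where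
  toFun f := ⟨(killOutside (T.erase v) (diagonalPoly hψ f) : MvPolynomial V K), by
    intro σ hσ
    rw [coeff_killOutside] at hσ
    have h : σ.support ⊆ T.erase v := by
      by_contra h0
      simp [h0] at hσ
    rw [if_pos h] at hσ
    exact ⟨h, (f.2 σ hσ).2⟩⟩
  map_add' f g := Subtype.ext (map_add (killOutside (T.erase v)) _ _)
  map_smul' r f := Subtype.ext <| by
    change killOutside (T.erase v) (killOutside T (ψ r) * diagonalPoly hψ f) =
      killOutside (T.erase v) (ψ r) * killOutside (T.erase v) (diagonalPoly hψ f)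
    rw [map_mul, killOutside_killOutside (Finset.erase_subset v T)]

section Exact

variable {T : Finset V} {v : V} (hv : v ∈ T) {e e' : Fin 3 → ℤ} {k : ℤ}
    (h : ∀ s, e' s = e s + (if l v = s then 1 else 0) + k)

lemma mulVar_injective : Function.Injective (mulVar hψ hv h) := by
  intro f g hfg
  have : (X v * diagonalPoly hψ f : MvPolynomial V K) = X v * diagonalPoly hψ g :=
    congrArg Subtype.val hfg
  exact diagonalPoly_injective hψ (mul_left_cancel₀ (X_ne_zero v) this)

lemma killVar_surjective : Function.Surjective (killVar hψ T v e) := by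
  intro f
  refine ⟨⟨(diagonalPoly hψ f : MvPolynomial V K), fun σ hσ =>
    ⟨(f.2 σ hσ).1.trans (Finset.erase_subset v T), (f.2 σ hσ).2⟩⟩, ?_⟩
  exact diagonalPoly_injective hψ (killOutside_eq_self fun σ hσ => (f.2 σ hσ).1)

lemma mulVar_exact_killVar : Function.Exact (mulVar hψ hv h) (killVar hψ T v e) := by
  intro f
  constructor
  · intro hf
    have hf' : killOutside (T.erase v) (diagonalPoly hψ f) = 0 := congrArg Subtype.val hf
    have hdvd : ∀ σ, coeff σ (diagonalPoly hψ f) ≠ 0 → σ v ≠ 0 := by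
      intro σ hσ h0
      have h1 := congrArg (coeff σ) hf'
      rw [coeff_killOutside, if_pos, coeff_zero] at h1
      · exact hσ h1
      · exact Finset.subset_erase.2 ⟨(f.2 σ hσ).1, by simpa using h0⟩
    refine ⟨⟨((diagonalPoly hψ f).divMonomial (Finsupp.single v 1) : MvPolynomial V K), ?_⟩, ?_⟩
    · intro σ hσ
      rw [coeff_divMonomial] at hσ
      have h1 := f.2 _ hσ
      refine ⟨?_, (IsDiagonal.add_single_iff h σ).1 h1.2⟩
      exact (Finsupp.support_mono le_add_self).trans h1.1
    · refine diagonalPoly_injective hψ ?_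
      change X v * (diagonalPoly hψ f).divMonomial (Finsupp.single v 1) = diagonalPoly hψ f
      ext σ
      rw [coeff_X_mul']
      split_ifs with hσ
      · rw [coeff_divMonomial, add_tsub_cancel_of_le]
        rwa [Finsupp.single_le_iff, Nat.one_le_iff_ne_zero, ← Finsupp.mem_support_iff]
      · by_contra h0
        exact hσ (Finsupp.mem_support_iff.2 (hdvd σ (Ne.symm h0)))
  · rintro ⟨g, rfl⟩
    refine diagonalPoly_injective hψ ?_
    change killOutside (T.erase v) (X v * diagonalPoly hψ g) = 0
    rw [map_mul, killOutside, aeval_X, if_neg (Finset.notMem_erase v T), zero_mul]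

end Exact

end MonomialModules

section DepthCondition

/-- The three letters `A`, `B`, `C` are all the letters there are. -/
def Exhausts (A B C : Fin 3) : Prop := ∀ s, s = A ∨ s = B ∨ s = C

instance (A B C : Fin 3) : Decidable (Exhausts A B C) :=
  inferInstanceAs (Decidable (∀ s, s = A ∨ s = B ∨ s = C))

lemma Exhausts.cases {A B C : Fin 3} (h : Exhausts A B C) :
    (A = 0 ∧ B = 1 ∧ C = 2) ∨ (A = 0 ∧ B = 2 ∧ C = 1) ∨ (A = 1 ∧ B = 0 ∧ C = 2) ∨
    (A = 1 ∧ B = 2 ∧ C = 0) ∨ (A = 2 ∧ B = 0 ∧ C = 1) ∨ (A = 2 ∧ B = 1 ∧ C = 0) := by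
  decide +revert

lemma Exhausts.ne {A B C : Fin 3} (h : Exhausts A B C) :
    A ≠ B ∧ A ≠ C ∧ B ≠ C ∧ B ≠ A ∧ C ≠ A ∧ C ≠ B := by
  decide +revert

lemma Exhausts.swap {A B C : Fin 3} (h : Exhausts A B C) : Exhausts B A C := by
  decide +revert

/-- The numerical condition for a diagonal module with `a`, `b`, `c` variables of the three
letters and shifts `x`, `y`, `z` to have depth at least `r`. -/
def DepthCondition (a b c x y z r : ℤ) : Prop :=
  (y ≤ x - a ∧ z ≤ x - a → r ≤ a) ∧ (x ≤ y - b ∧ z ≤ y - b → r ≤ b) ∧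
  (x ≤ z - c ∧ y ≤ z - c → r ≤ c) ∧ (z ≤ x - a ∧ z ≤ y - b → r ≤ a + b - 1) ∧
  (y ≤ x - a ∧ y ≤ z - c → r ≤ a + c - 1) ∧ (x ≤ y - b ∧ x ≤ z - c → r ≤ b + c - 1) ∧
  r ≤ a + b + c - 2

lemma depthCondition_of_exhausts {A B C : Fin 3} (h : Exhausts A B C) {c e : Fin 3 → ℤ} {r : ℤ} :
    DepthCondition (c A) (c B) (c C) (e A) (e B) (e C) r ↔
      DepthCondition (c 0) (c 1) (c 2) (e 0) (e 1) (e 2) r := by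
  unfold DepthCondition
  rcases h.cases with ⟨rfl, rfl, rfl⟩ | ⟨rfl, rfl, rfl⟩ | ⟨rfl, rfl, rfl⟩ | ⟨rfl, rfl, rfl⟩ |
    ⟨rfl, rfl, rfl⟩ | ⟨rfl, rfl, rfl⟩ <;> grind

lemma exists_sorted (e c : Fin 3 → ℤ) : ∃ A B C, Exhausts A B C ∧
    (e A < e B ∨ e A = e B ∧ c B ≤ c A) ∧ (e B < e C ∨ e B = e C ∧ c C ≤ c B) := by
  by_contra! h
  have h1 := h 0 1 2 (by decide)
  have h2 := h 0 2 1 (by decide)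
  have h3 := h 1 0 2 (by decide)
  have h4 := h 1 2 0 (by decide)
  have h5 := h 2 0 1 (by decide)
  have h6 := h 2 1 0 (by decide)
  omega

namespace DepthCondition

variable {a b c x y z r : ℤ}

lemma first (ha : 1 ≤ a) (hb : 1 ≤ b) (hc : 1 ≤ c) (h : DepthCondition a b c x y z (r + 1))
    (hxy : x < y ∨ x = y ∧ b ≤ a) (hyz : y < z ∨ y = z ∧ c ≤ b) :
    DepthCondition (a - 1) b c x y z r := by
  unfold DepthCondition at *
  omega

lemma second (ha : 1 ≤ a) (hb : 1 ≤ b) (hc : 1 ≤ c) (h : DepthCondition a b c x y z (r + 1))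
    (hxy : x < y ∨ x = y ∧ b ≤ a) (hyz : y < z ∨ y = z ∧ c ≤ b) :
    DepthCondition a (b - 1) c (x + 1) y z r := by
  unfold DepthCondition at *
  omega

lemma third (ha : 1 ≤ a) (hb : 1 ≤ b) (hc : 1 ≤ c) (h : DepthCondition a b c x y z (r + 1))
    (hxy : x < y ∨ x = y ∧ b ≤ a) (hyz : y < z ∨ y = z ∧ c ≤ b) :
    DepthCondition a b (c - 1) (x + 1) (y + 1) z r := by
  unfold DepthCondition at *
  omega

end DepthCondition

end DepthCondition

section DiagonalDepth

universe u

variable {K : Type u} [Field K] {V : Type} [DecidableEq V] (l : V → Fin 3)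

/-- The number of variables of `T` carrying the letter `s`. -/
def letterCount (T : Finset V) (s : Fin 3) : ℤ := ((T.filter (l · = s)).card : ℤ)

omit [DecidableEq V] in
lemma letterCount_nonneg (T : Finset V) (s : Fin 3) : 0 ≤ letterCount l T s :=
  Int.natCast_nonneg _

omit [DecidableEq V] in
lemma exists_mem_of_letterCount {T : Finset V} {s : Fin 3} (h : 1 ≤ letterCount l T s) :
    ∃ v ∈ T, l v = s := by
  have h1 : 0 < (T.filter (l · = s)).card := by unfold letterCount at h; omega
  obtain ⟨v, hv⟩ := Finset.card_pos.1 h1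
  exact ⟨v, Finset.mem_filter.1 hv⟩

lemma letterCount_erase {T : Finset V} {v : V} (hv : v ∈ T) (s : Fin 3) :
    letterCount l (T.erase v) s = letterCount l T s - if l v = s then 1 else 0 := by
  unfold letterCount
  rw [Finset.filter_erase]
  split_ifs with h
  · have hm : v ∈ T.filter (l · = s) := Finset.mem_filter.2 ⟨hv, h⟩
    have := Finset.card_erase_add_one hm
    omega
  · rw [Finset.erase_eq_of_notMem (s := T.filter (l · = s))
      fun hm => h (Finset.mem_filter.1 hm).2, sub_zero]

omit [DecidableEq V] in
lemma letterDegree_eq_zero_of_letterCount [Fintype V] {T : Finset V} {s : Fin 3}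
    (h : letterCount l T s ≤ 0) {σ : V →₀ ℕ} (hσ : σ.support ⊆ T) : letterDegree l s σ = 0 := by
  rw [letterDegree_eq_zero_iff]
  intro v hv
  by_contra h0
  have hm : v ∈ T.filter (l · = s) :=
    Finset.mem_filter.2 ⟨hσ (Finsupp.mem_support_iff.2 h0), hv⟩
  have := Finset.card_pos.2 ⟨v, hm⟩
  unfold letterCount at h
  omega

/-- The shift `e` changed by `k` at the letter `s`. -/
def shiftAt (e : Fin 3 → ℤ) (A : Fin 3) (k : ℤ) : Fin 3 → ℤ :=
  fun s => e s + if A = s then k else 0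

variable [Fintype V] {R : Type u} [CommRing R] {l} {ψ : R →+* MvPolynomial V K}
variable (hψ : ∀ r σ, coeff σ (ψ r) ≠ 0 → IsDiagonal l 0 σ) {I : Ideal R}

lemma diagonalModule_subsingleton {T : Finset V} {e : Fin 3 → ℤ} {s₀ : Fin 3}
    (h : letterCount l T s₀ ≤ 0) (he : ∃ s, e s₀ < e s) :
    Subsingleton (diagonalModule hψ T e) := by
  refine subsingleton_of_forall_eq 0 fun f => ?_
  refine diagonalPoly_injective hψ ?_
  change diagonalPoly hψ f = 0
  ext σ
  rw [coeff_zero]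
  by_contra hσ
  obtain ⟨h1, t, ht⟩ := f.2 σ hσ
  obtain ⟨s, hs⟩ := he
  have h2 := letterDegree_eq_zero_of_letterCount l h h1
  have h3 := letterDegree_nonneg l s σ
  rw [ht] at h2 h3
  omega

variable (hI : ∀ u v w, Exhausts (l u) (l v) (l w) → ∃ r ∈ I, ψ r = X u * X v * X w)

include hI in
theorem extDepthGE_of_depthCondition (r : ℕ) (T : Finset V) (e : Fin 3 → ℤ)
    (h : DepthCondition (letterCount l T 0) (letterCount l T 1) (letterCount l T 2)
      (e 0) (e 1) (e 2) r) : ExtDepthGE I r (diagonalModule hψ T e) := by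
  induction r generalizing T e with
  | zero => intro k hk; simp at hk
  | succ r ih =>
    by_cases h0 : ∃ s, letterCount l T s ≤ 0
    · obtain ⟨s, hs⟩ := h0
      have : Subsingleton (diagonalModule hψ T e) := by
        refine diagonalModule_subsingleton hψ hs ?_
        by_contra! hle
        have h1 := hle 0
        have h2 := hle 1
        have h3 := hle 2
        unfold DepthCondition at h
        fin_cases s <;> dsimp at hs h1 h2 h3 <;> omega
      exact ExtDepthGE.of_subsingleton
    push Not at h0
    obtain ⟨A, B, C, hABC, hAB, hBC⟩ := exists_sorted e (letterCount l T)
    obtain ⟨u, hu, rfl⟩ := exists_mem_of_letterCount l (h0 A)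
    obtain ⟨v, hv, rfl⟩ := exists_mem_of_letterCount l (h0 B)
    obtain ⟨w, hw, rfl⟩ := exists_mem_of_letterCount l (h0 C)
    obtain ⟨x, hxI, hx⟩ := hI u v w hABC
    obtain ⟨n1, n2, n3, n4, n5, n6⟩ := hABC.ne
    rw [← depthCondition_of_exhausts hABC] at h
    push_cast at h
    have hs1 : ∀ s, shiftAt e (l u) 1 s = e s + (if l u = s then 1 else 0) + 0 := by
      intro s; rw [shiftAt, add_zero]
    have hs2 : ∀ s, shiftAt (shiftAt e (l u) 1) (l v) 1 s =
        shiftAt e (l u) 1 s + (if l v = s then 1 else 0) + 0 := by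
      intro s; rw [shiftAt, add_zero]
    have hs3 : ∀ s, e s = shiftAt (shiftAt e (l u) 1) (l v) 1 s +
        (if l w = s then 1 else 0) + (-1) := by
      intro s
      unfold shiftAt
      rcases hABC s with rfl | rfl | rfl <;> simp [*]
    refine ExtDepthGE.succ_of_factorization hxI
      (mulVar_injective hψ hu hs1) (mulVar_exact_killVar hψ hu hs1) (killVar_surjective hψ)
      (mulVar_injective hψ hv hs2) (mulVar_exact_killVar hψ hv hs2) (killVar_surjective hψ)
      (mulVar_injective hψ hw hs3) (mulVar_exact_killVar hψ hw hs3) (killVar_surjective hψ)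
      (ih _ _ ?_) (ih _ _ ?_) (ih _ _ ?_) fun f => ?_
    · have := h.first (h0 _) (h0 _) (h0 _) hAB hBC
      rw [← depthCondition_of_exhausts hABC]
      simpa [letterCount_erase l hu, n1, n2, n3, n4, n5, n6] using this
    · have := h.second (h0 _) (h0 _) (h0 _) hAB hBC
      rw [← depthCondition_of_exhausts hABC]
      simpa [letterCount_erase l hv, shiftAt, n1, n2, n3, n4, n5, n6] using this
    · have := h.third (h0 _) (h0 _) (h0 _) hAB hBC
      rw [← depthCondition_of_exhausts hABC]
      simpa [letterCount_erase l hw, shiftAt, n1, n2, n3, n4, n5, n6] using this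
    · refine diagonalPoly_injective hψ ?_
      rw [diagonalPoly_smul, hx]
      change X u * (X v * (X w * diagonalPoly hψ f)) = _
      simp only [map_mul, killOutside, aeval_X, if_pos hu, if_pos hv, if_pos hw]
      ring

end DiagonalDepth

section DiagonalDepthBound

universe u

variable {K : Type u} [Field K] {V : Type} [DecidableEq V] [Fintype V] {l : V → Fin 3}
variable {R : Type u} [CommRing R] {ψ : R →+* MvPolynomial V K}
variable (hψ : ∀ r σ, coeff σ (ψ r) ≠ 0 → IsDiagonal l 0 σ) {I : Ideal R}

lemma ExtDepthGE.erase {T : Finset V} {v : V} (hv : v ∈ T) {e : Fin 3 → ℤ} {r : ℕ}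
    (h : ExtDepthGE I (r + 1) (diagonalModule hψ T e))
    (h' : ExtDepthGE I r (diagonalModule hψ T (shiftAt e (l v) (-1)))) :
    ExtDepthGE I r (diagonalModule hψ (T.erase v) (shiftAt e (l v) (-1))) := by
  have hs : ∀ s, e s = shiftAt e (l v) (-1) s + (if l v = s then 1 else 0) + 0 := by
    intro s; unfold shiftAt; split_ifs <;> ring
  exact ExtDepthGE.right (mulVar_injective hψ hv hs) (mulVar_exact_killVar hψ hv hs)
    (killVar_surjective hψ) h h'

lemma ExtDepthGE.of_erase {T : Finset V} {v : V} (hv : v ∈ T) {e : Fin 3 → ℤ} {r : ℕ}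
    (h : ExtDepthGE I r (diagonalModule hψ T e))
    (h' : ExtDepthGE I r (diagonalModule hψ (T.erase v) (shiftAt e (l v) (-1)))) :
    ExtDepthGE I r (diagonalModule hψ T (shiftAt e (l v) (-1))) := by
  have hs : ∀ s, e s = shiftAt e (l v) (-1) s + (if l v = s then 1 else 0) + 0 := by
    intro s; unfold shiftAt; split_ifs <;> ring
  exact ExtDepthGE.middle (mulVar_injective hψ hv hs) (mulVar_exact_killVar hψ hv hs)
    (killVar_surjective hψ) h h'

variable (hI₀ : ∀ x ∈ I, coeff 0 (ψ x) = 0)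
  (hI : ∀ u v w, Exhausts (l u) (l v) (l w) → ∃ r ∈ I, ψ r = X u * X v * X w)

include hI₀ in
lemma not_extDepthGE_one {A B C : Fin 3} (hABC : Exhausts A B C) {T : Finset V} {e : Fin 3 → ℤ}
    (hA : letterCount l T A ≤ 0) (hB : 1 ≤ letterCount l T B) (hC : 1 ≤ letterCount l T C)
    (hAB : e B ≤ e A) (hAC : e C ≤ e A) : ¬ ExtDepthGE I 1 (diagonalModule hψ T e) := by
  obtain ⟨v, hv, rfl⟩ := exists_mem_of_letterCount l hB
  obtain ⟨w, hw, rfl⟩ := exists_mem_of_letterCount l hC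
  obtain ⟨n1, n2, n3, n4, n5, n6⟩ := hABC.ne
  let σ : V →₀ ℕ := Finsupp.single v (e A - e (l v)).toNat +
    Finsupp.single w (e A - e (l w)).toNat
  have hσT : σ.support ⊆ T := by
    refine Finsupp.support_add.trans (Finset.union_subset ?_ ?_) <;>
    exact Finsupp.support_single_subset.trans (by simpa)
  have hσ : IsDiagonal l e σ := by
    refine ⟨e A, fun s => ?_⟩
    rw [letterDegree_add, letterDegree_single, letterDegree_single]
    rcases hABC s with rfl | rfl | rfl <;> simp [n3, n4, n5, n6, hAB, hAC]
  let f : diagonalModule hψ T e := ⟨(monomial σ 1 : MvPolynomial V K), fun τ hτ => by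
    have : σ = τ := by
      by_contra h0
      exact hτ (by rw [coeff_monomial, if_neg h0])
    exact this ▸ ⟨hσT, hσ⟩⟩
  refine ExtDepthGE.not_one_of_smul_eq_zero (v := f) (fun h0 => ?_) fun x hx => ?_
  · have h1 : (monomial σ 1 : MvPolynomial V K) = 0 := congrArg (diagonalPoly hψ) h0
    simp at h1
  · have h1 : killOutside T (ψ x) = 0 := by
      ext τ
      rw [coeff_killOutside, coeff_zero]
      split_ifs with hτ
      · by_contra h2
        obtain ⟨t, ht⟩ := hψ x τ h2
        have h3 := ht A
        rw [letterDegree_eq_zero_of_letterCount l hA hτ] at h3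
        have h4 : τ = 0 := by
          ext y
          refine (letterDegree_eq_zero_iff l (l y) τ).1 ?_ y rfl
          rw [ht, Pi.zero_apply] at *
          omega
        exact h2 (h4 ▸ hI₀ x hx)
      · rfl
    refine diagonalPoly_injective hψ ?_
    rw [diagonalPoly_smul, h1, zero_mul]
    rfl

include hI₀ hI

lemma not_extDepthGE_of_one_letter {A B C : Fin 3} (hABC : Exhausts A B C) (k : ℕ)
    (T : Finset V) (e : Fin 3 → ℤ) (hA : letterCount l T A = k) (hB : 1 ≤ letterCount l T B)
    (hC : 1 ≤ letterCount l T C) (hAB : e B ≤ e A - letterCount l T A)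
    (hAC : e C ≤ e A - letterCount l T A) :
    ¬ ExtDepthGE I (k + 1) (diagonalModule hψ T e) := by
  induction k generalizing T e with
  | zero =>
    exact not_extDepthGE_one hψ hI₀ hABC (by simp [hA]) hB hC (by simpa [hA] using hAB)
      (by simpa [hA] using hAC)
  | succ k ih =>
    intro h
    obtain ⟨v, hv, rfl⟩ := exists_mem_of_letterCount l (by rw [hA]; push_cast; omega)
    obtain ⟨n1, n2, n3, n4, n5, n6⟩ := hABC.ne
    refine ih (T.erase v) (shiftAt e (l v) (-1)) ?_ ?_ ?_ ?_ ?_ (ExtDepthGE.erase hψ hv h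
      (extDepthGE_of_depthCondition hψ hI _ _ _ ?_))
    iterate 5
      simp only [letterCount_erase l hv, shiftAt, if_pos, if_neg n1, if_neg n2]
      push_cast at *
      omega
    rw [← depthCondition_of_exhausts hABC]
    simp only [shiftAt, if_pos, if_neg n1, if_neg n2]
    unfold DepthCondition
    push_cast at *
    omega

lemma not_extDepthGE_of_two_letters {C : Fin 3} (k : ℕ) (A B : Fin 3) (hABC : Exhausts A B C)
    (T : Finset V) (e : Fin 3 → ℤ)
    (hk : letterCount l T A + letterCount l T B = k)
    (hA : 1 ≤ letterCount l T A) (hB : 1 ≤ letterCount l T B) (hC : 1 ≤ letterCount l T C)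
    (hAB : e B < e A + letterCount l T B) (hBA : e A < e B + letterCount l T A)
    (hAC : e C ≤ e A - letterCount l T A) (hBC : e C ≤ e B - letterCount l T B) :
    ¬ ExtDepthGE I k (diagonalModule hψ T e) := by
  induction k generalizing A B T e with
  | zero => push_cast at hk; omega
  | succ k ih =>
    have hlong : ∀ A B, Exhausts A B C → letterCount l T A + letterCount l T B = (k + 1 : ℕ) →
        2 ≤ letterCount l T A → 1 ≤ letterCount l T B → e B + 1 < e A + letterCount l T B →
        e A < e B + letterCount l T A → e C ≤ e A - letterCount l T A →
        e C ≤ e B - letterCount l T B → ¬ ExtDepthGE I (k + 1) (diagonalModule hψ T e) := by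
      intro A B hABC hk hA hB hAB hBA hAC hBC h
      obtain ⟨v, hv, rfl⟩ := exists_mem_of_letterCount l (one_le_two.trans hA)
      obtain ⟨n1, n2, n3, n4, n5, n6⟩ := hABC.ne
      refine ih _ _ hABC (T.erase v) (shiftAt e (l v) (-1)) ?_ ?_ ?_ ?_ ?_ ?_ ?_ ?_
        (ExtDepthGE.erase hψ hv h (extDepthGE_of_depthCondition hψ hI _ _ _ ?_))
      iterate 8
        simp only [letterCount_erase l hv, shiftAt, if_pos, if_neg n1, if_neg n2]
        push_cast at *
        omega
      rw [← depthCondition_of_exhausts hABC]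
      simp only [shiftAt, if_pos, if_neg n1, if_neg n2]
      unfold DepthCondition
      push_cast at *
      omega
    have hshort : ∀ A B, Exhausts A B C → letterCount l T A + letterCount l T B = (k + 1 : ℕ) →
        letterCount l T A = 1 → 1 ≤ letterCount l T B → e A = e B →
        e C ≤ e A - letterCount l T A → e C ≤ e B - letterCount l T B →
        ¬ ExtDepthGE I (k + 1) (diagonalModule hψ T e) := by
      intro A B hABC hk hA hB hAB hAC hBC h
      obtain ⟨v, hv, rfl⟩ := exists_mem_of_letterCount l hA.ge
      obtain ⟨w, hw, rfl⟩ := exists_mem_of_letterCount l hB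
      obtain ⟨n1, n2, n3, n4, n5, n6⟩ := hABC.ne
      have : Subsingleton (diagonalModule hψ (T.erase v) (shiftAt e (l v) (-1))) := by
        refine diagonalModule_subsingleton hψ (s₀ := l v) ?_ ⟨l w, ?_⟩
        · simp [letterCount_erase l hv, hA]
        · simp [shiftAt, n1, hAB]
      have h' := ExtDepthGE.erase hψ hw
        (ExtDepthGE.of_erase hψ hv h ExtDepthGE.of_subsingleton)
        (extDepthGE_of_depthCondition hψ hI _ _ _ (by
          rw [← depthCondition_of_exhausts hABC]
          simp only [shiftAt, if_pos, if_neg n1, if_neg n2, if_neg n3, if_neg n4]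
          unfold DepthCondition
          push_cast at *
          omega))
      by_cases hB2 : 2 ≤ letterCount l T (l w)
      · revert h'
        apply ih _ _ hABC
        all_goals
          simp only [letterCount_erase l hw, shiftAt, if_pos, if_neg n1, if_neg n2, if_neg n3,
            if_neg n4]
          push_cast at *
          omega
      · obtain rfl : k = 1 := by push_cast at hk; omega
        revert h'
        apply not_extDepthGE_one hψ hI₀ hABC.swap
        all_goals
          simp only [letterCount_erase l hw, shiftAt, if_pos, if_neg n1, if_neg n2, if_neg n3,
            if_neg n4]
          omega
    have hk' := (add_comm _ _).trans hk
    by_cases h1 : 2 ≤ letterCount l T A ∧ e B + 1 < e A + letterCount l T B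
    · exact hlong A B hABC hk h1.1 hB h1.2 hBA hAC hBC
    by_cases h2 : 2 ≤ letterCount l T B ∧ e A + 1 < e B + letterCount l T A
    · exact hlong B A hABC.swap hk' h2.1 hA h2.2 hAB hBC hAC
    by_cases h3 : letterCount l T A = 1
    · exact hshort A B hABC hk h3 hB (by omega) hAC hBC
    · exact hshort B A hABC.swap hk' (by omega) hA (by omega) hBC hAC

theorem extDepthGE_iff_depthCondition (T : Finset V) (e : Fin 3 → ℤ)
    (h : ∀ s, 1 ≤ letterCount l T s) (r : ℕ)
    (hr : (r : ℤ) ≤ letterCount l T 0 + letterCount l T 1 + letterCount l T 2 - 2) :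
    ExtDepthGE I r (diagonalModule hψ T e) ↔
      DepthCondition (letterCount l T 0) (letterCount l T 1) (letterCount l T 2)
        (e 0) (e 1) (e 2) r := by
  refine ⟨fun hD => ?_, extDepthGE_of_depthCondition hψ hI r T e⟩
  have hone : ∀ A B C, Exhausts A B C → e B ≤ e A - letterCount l T A ∧
      e C ≤ e A - letterCount l T A → r ≤ letterCount l T A := by
    intro A B C hABC hA
    by_contra! hlt
    obtain ⟨k, hk⟩ := Int.eq_ofNat_of_zero_le (letterCount_nonneg l T A)
    exact not_extDepthGE_of_one_letter hψ hI₀ hI hABC k T e hk (h B) (h C) hA.1 hA.2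
      (hD.mono (by omega))
  have htwo : ∀ A B C, Exhausts A B C → e C ≤ e A - letterCount l T A ∧
      e C ≤ e B - letterCount l T B → r ≤ letterCount l T A + letterCount l T B - 1 := by
    intro A B C hABC hC
    by_contra! hlt
    have hA := h A
    have hB := h B
    have h1 := hone A B C hABC
    have h2 := hone B A C hABC.swap
    obtain ⟨k, hk⟩ := Int.eq_ofNat_of_zero_le (add_nonneg (letterCount_nonneg l T A)
      (letterCount_nonneg l T B))
    exact not_extDepthGE_of_two_letters hψ hI₀ hI k A B hABC T e hk hA hB (h C) (by omega)
      (by omega) hC.1 hC.2 (hD.mono (by omega))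
  have h1 := hone 0 1 2 (by decide)
  have h2 := hone 1 0 2 (by decide)
  have h3 := hone 2 0 1 (by decide)
  exact ⟨h1, h2, h3, htwo 0 1 2 (by decide), htwo 0 2 1 (by decide), htwo 1 2 0 (by decide), hr⟩

end DiagonalDepthBound

section SegreModules

universe u

variable {K : Type u} [Field K] {m n p : ℕ}

/-- The letter carried by each of the variables `X`, `Y`, `Z`. -/
def segreLetter (m n p : ℕ) : Fin m ⊕ Fin n ⊕ Fin p → Fin 3 :=
  Sum.elim (fun _ => 0) (Sum.elim (fun _ => 1) fun _ => 2)

lemma isDiagonal_segreLetter_iff {i j : ℤ} {σ : Fin m ⊕ Fin n ⊕ Fin p →₀ ℕ} :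
    IsDiagonal (segreLetter m n p) ![0, i, j] σ ↔
      asum m n p σ = bsum m n p σ + i ∧ asum m n p σ = csum m n p σ + j := by
  have h0 : letterDegree (segreLetter m n p) 0 σ = asum m n p σ := by
    simp [letterDegree, segreLetter, asum, Fintype.sum_sum_type]
  have h1 : letterDegree (segreLetter m n p) 1 σ = bsum m n p σ := by
    simp [letterDegree, segreLetter, bsum, Fintype.sum_sum_type]
  have h2 : letterDegree (segreLetter m n p) 2 σ = csum m n p σ := by
    simp [letterDegree, segreLetter, csum, Fintype.sum_sum_type]
  simp only [IsDiagonal, Fin.forall_fin_succ, IsEmpty.forall_iff]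
  constructor
  · rintro ⟨t, h⟩
    simp [h0, h1, h2] at h
    omega
  · intro h
    refine ⟨asum m n p σ, ?_⟩
    simp [h0, h1, h2]
    omega

lemma isDiagonal_segreLetter_zero_iff {σ : Fin m ⊕ Fin n ⊕ Fin p →₀ ℕ} :
    IsDiagonal (segreLetter m n p) 0 σ ↔
      asum m n p σ = bsum m n p σ ∧ asum m n p σ = csum m n p σ := by
  have h : (0 : Fin 3 → ℤ) = ![0, 0, 0] := by ext s; fin_cases s <;> rfl
  rw [h, isDiagonal_segreLetter_iff, add_zero, add_zero]

lemma letterCount_segreLetter : letterCount (segreLetter m n p) Finset.univ 0 = m ∧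
    letterCount (segreLetter m n p) Finset.univ 1 = n ∧
    letterCount (segreLetter m n p) Finset.univ 2 = p := by
  have h : ∀ s, letterCount (segreLetter m n p) Finset.univ s =
      ∑ v, if segreLetter m n p v = s then 1 else 0 := fun s => by
    rw [letterCount, Finset.card_filter]
    push_cast
    rfl
  rw [h, h, h]
  simp [segreLetter, Fintype.sum_sum_type]

lemma mem_segreRing_iff {f : MvPolynomial (Fin m ⊕ Fin n ⊕ Fin p) K} :
    f ∈ segreRing K m n p ↔ ∀ σ, coeff σ f ≠ 0 → IsDiagonal (segreLetter m n p) 0 σ := by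
  constructor
  · intro hf
    induction hf using Algebra.adjoin_induction with
    | mem f hf =>
      obtain ⟨τ, h1, h2, rfl⟩ := hf
      intro σ hσ
      rw [coeff_monomial] at hσ
      obtain rfl : τ = σ := by by_contra h0; simp [h0] at hσ
      exact isDiagonal_segreLetter_zero_iff.2 ⟨h1, h2⟩
    | algebraMap c =>
      intro σ hσ
      rw [algebraMap_eq, coeff_C] at hσ
      obtain rfl : 0 = σ := by by_contra h0; simp [h0] at hσ
      exact isDiagonal_segreLetter_zero_iff.2 (by simp [asum, bsum, csum])
    | add f g _ _ hf hg =>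
      intro σ hσ
      by_cases h0 : coeff σ f = 0
      · exact hg σ fun h1 => hσ (by rw [coeff_add, h0, h1, add_zero])
      · exact hf σ h0
    | mul f g _ _ hf hg =>
      intro σ hσ
      obtain ⟨τ, ρ, rfl, h1, h2⟩ := exists_coeff_ne_zero_of_mul hσ
      exact (hf τ h1).add (hg ρ h2)
  · intro h
    rw [f.as_sum]
    refine Subalgebra.sum_mem _ fun σ hσ => ?_
    rw [← mul_one (coeff σ f), ← C_mul_monomial]
    refine Subalgebra.mul_mem _ (Subalgebra.algebraMap_mem _ _) (Algebra.subset_adjoin ?_)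
    have := isDiagonal_segreLetter_zero_iff.1 (h σ (mem_support_iff.1 hσ))
    exact ⟨σ, this.1, this.2, rfl⟩

lemma mem_segreClassModule_iff {i j : ℤ} {f : MvPolynomial (Fin m ⊕ Fin n ⊕ Fin p) K} :
    f ∈ segreClassModule K m n p i j ↔
      ∀ σ, coeff σ f ≠ 0 → IsDiagonal (segreLetter m n p) ![0, i, j] σ := by
  constructor
  · intro hf
    induction hf using Submodule.span_induction with
    | mem f hf =>
      obtain ⟨τ, h1, h2, rfl⟩ := hf
      intro σ hσ
      rw [coeff_monomial] at hσ
      obtain rfl : τ = σ := by by_contra h0; simp [h0] at hσ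
      exact isDiagonal_segreLetter_iff.2 ⟨h1, h2⟩
    | zero => intro σ hσ; simp at hσ
    | add f g _ _ hf hg =>
      intro σ hσ
      by_cases h0 : coeff σ f = 0
      · exact hg σ fun h1 => hσ (by rw [coeff_add, h0, h1, add_zero])
      · exact hf σ h0
    | smul r g _ hg =>
      intro σ hσ
      obtain ⟨τ, ρ, rfl, h1, h2⟩ := exists_coeff_ne_zero_of_mul hσ
      exact (mem_segreRing_iff.1 r.2 τ h1).add (hg ρ h2)
  · intro h
    rw [f.as_sum]
    refine Submodule.sum_mem _ fun σ hσ => ?_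
    rw [← mul_one (coeff σ f), ← C_mul_monomial]
    refine Submodule.smul_mem _ (⟨C (coeff σ f), Subalgebra.algebraMap_mem _ _⟩ : segreRing K m n p)
      (Submodule.subset_span ?_)
    have := isDiagonal_segreLetter_iff.1 (h σ (mem_support_iff.1 hσ))
    exact ⟨σ, this.1, this.2, rfl⟩

lemma isDiagonal_of_coeff_segreRing (r : segreRing K m n p) (σ : Fin m ⊕ Fin n ⊕ Fin p →₀ ℕ)
    (h : coeff σ ((segreRing K m n p).val.toRingHom r) ≠ 0) : IsDiagonal (segreLetter m n p) 0 σ :=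
  mem_segreRing_iff.1 r.2 σ h

/-- The class module as a diagonal module. -/
noncomputable def segreClassModuleEquiv (i j : ℤ) :
    segreClassModule K m n p i j ≃ₗ[segreRing K m n p]
    diagonalModule (isDiagonal_of_coeff_segreRing (K := K) (m := m) (n := n) (p := p))
      Finset.univ ![0, i, j] where
  toFun f := ⟨(f : MvPolynomial (Fin m ⊕ Fin n ⊕ Fin p) K), fun σ hσ =>
    ⟨Finset.subset_univ _, mem_segreClassModule_iff.1 f.2 σ hσ⟩⟩
  invFun f := ⟨diagonalPoly _ f, mem_segreClassModule_iff.2 fun σ hσ => (f.2 σ hσ).2⟩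
  map_add' _ _ := rfl
  map_smul' r f := Subtype.ext <| by
    change (r : MvPolynomial (Fin m ⊕ Fin n ⊕ Fin p) K) * f =
      killOutside Finset.univ (r : MvPolynomial (Fin m ⊕ Fin n ⊕ Fin p) K) * f
    rw [killOutside_eq_self fun _ _ => Finset.subset_univ _]
  left_inv _ := rfl
  right_inv _ := rfl

lemma coeff_zero_of_mem_segreIrrelevantIdeal (x : segreRing K m n p)
    (hx : x ∈ segreIrrelevantIdeal K m n p) :
    coeff 0 ((segreRing K m n p).val.toRingHom x) = 0 := by
  have h : segreIrrelevantIdeal K m n p ≤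
      RingHom.ker (constantCoeff.comp (segreRing K m n p).val.toRingHom) := by
    refine Ideal.span_le.2 ?_
    rintro r ⟨σ, hσ, hr⟩
    change constantCoeff (r : MvPolynomial (Fin m ⊕ Fin n ⊕ Fin p) K) = 0
    rw [hr, constantCoeff_monomial, if_neg hσ]
  exact h hx

lemma exists_mem_segreIrrelevantIdeal (u v w : Fin m ⊕ Fin n ⊕ Fin p)
    (h : Exhausts (segreLetter m n p u) (segreLetter m n p v) (segreLetter m n p w)) :
    ∃ r ∈ segreIrrelevantIdeal K m n p,
      (segreRing K m n p).val.toRingHom r = X u * X v * X w := by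
  let σ : Fin m ⊕ Fin n ⊕ Fin p →₀ ℕ :=
    Finsupp.single u 1 + Finsupp.single v 1 + Finsupp.single w 1
  have hX : (X u * X v * X w : MvPolynomial (Fin m ⊕ Fin n ⊕ Fin p) K) = monomial σ 1 := by
    simp only [X, monomial_mul, mul_one, σ]
  have hσ : IsDiagonal (segreLetter m n p) 0 σ := by
    refine ⟨1, fun s => ?_⟩
    obtain ⟨n1, n2, n3, n4, n5, n6⟩ := h.ne
    simp only [σ, letterDegree_add, letterDegree_single]
    rcases h s with rfl | rfl | rfl <;> simp [n1, n2, n3, n4, n5, n6]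
  have hmem : (monomial σ 1 : MvPolynomial (Fin m ⊕ Fin n ⊕ Fin p) K) ∈ segreRing K m n p := by
    refine Algebra.subset_adjoin ?_
    have := isDiagonal_segreLetter_zero_iff.1 hσ
    exact ⟨σ, this.1, this.2, rfl⟩
  refine ⟨⟨monomial σ 1, hmem⟩, Ideal.subset_span ⟨σ, ?_, rfl⟩, hX.symm⟩
  intro h0
  have := DFunLike.congr_fun h0 u
  simp [σ] at this

end SegreModules

section SegreNoetherian

universe u

variable {K : Type u} [Field K]

section DiagonalPart

variable {V : Type} [Fintype V] (l : V → Fin 3)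

open Classical in
/-- The `K`-linear projection onto the span of the diagonal monomials with shift `e`. -/
noncomputable def diagonalPart (e : Fin 3 → ℤ) : MvPolynomial V K →ₗ[K] MvPolynomial V K :=
  (basisMonomials V K).constr K fun σ => if IsDiagonal l e σ then monomial σ 1 else 0

open Classical in
lemma coeff_diagonalPart (e : Fin 3 → ℤ) (f : MvPolynomial V K) (σ : V →₀ ℕ) :
    coeff σ (diagonalPart l e f) = if IsDiagonal l e σ then coeff σ f else 0 := by
  induction f using MvPolynomial.induction_on' with
  | add p q hp hq => rw [map_add, coeff_add, hp, hq]; split_ifs <;> simp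
  | monomial τ c =>
    have h : (monomial τ c : MvPolynomial V K) = c • basisMonomials V K τ := by
      rw [coe_basisMonomials, smul_monomial, smul_eq_mul, mul_one]
    have h' : diagonalPart l e (monomial τ c) =
        if IsDiagonal l e τ then monomial τ c else 0 := by
      rw [h, map_smul, diagonalPart, Module.Basis.constr_basis]
      split_ifs
      · rw [coe_basisMonomials]
      · rw [smul_zero]
    rw [h']
    by_cases hστ : τ = σ
    · subst hστ; split_ifs <;> simp
    · split_ifs <;> simp [coeff_monomial, hστ]

variable {l}

lemma diagonalPart_mul {e : Fin 3 → ℤ} (f : MvPolynomial V K) {g : MvPolynomial V K}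
    (hg : ∀ σ, coeff σ g ≠ 0 → IsDiagonal l e σ) :
    diagonalPart l e (f * g) = diagonalPart l 0 f * g := by
  classical
  ext σ
  rw [coeff_diagonalPart, coeff_mul, coeff_mul]
  split_ifs with hσ
  · refine Finset.sum_congr rfl fun x hx => ?_
    rw [coeff_diagonalPart]
    split_ifs with h
    · rfl
    · by_cases h0 : coeff x.2 g = 0
      · rw [h0, mul_zero, mul_zero]
      · rw [← Finset.HasAntidiagonal.mem_antidiagonal.1 hx] at hσ
        exact absurd (hσ.of_add (hg _ h0)) h
  · refine (Finset.sum_eq_zero fun x hx => ?_).symm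
    rw [coeff_diagonalPart]
    split_ifs with h
    · by_cases h0 : coeff x.2 g = 0
      · rw [h0, mul_zero]
      · rw [← Finset.HasAntidiagonal.mem_antidiagonal.1 hx] at hσ
        exact absurd (h.add (hg _ h0)) hσ
    · rw [zero_mul]

end DiagonalPart

variable {m n p : ℕ}

lemma diagonalPart_mem_segreRing (f : MvPolynomial (Fin m ⊕ Fin n ⊕ Fin p) K) :
    diagonalPart (segreLetter m n p) 0 f ∈ segreRing K m n p := by
  refine mem_segreRing_iff.2 fun σ hσ => ?_
  rw [coeff_diagonalPart] at hσ
  by_contra h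
  rw [if_neg h] at hσ
  exact hσ rfl

lemma mem_of_mem_span {i j : ℤ} (L : Submodule (segreRing K m n p) (segreClassModule K m n p i j))
    (f : segreClassModule K m n p i j)
    (hf : (f : MvPolynomial (Fin m ⊕ Fin n ⊕ Fin p) K) ∈
      Ideal.span (Subtype.val '' (L : Set (segreClassModule K m n p i j)))) :
    f ∈ L := by
  have key : ∀ g ∈ Ideal.span (Subtype.val '' (L : Set (segreClassModule K m n p i j))),
      ∀ q : MvPolynomial (Fin m ⊕ Fin n ⊕ Fin p) K,
        ∃ x ∈ L, (x : MvPolynomial (Fin m ⊕ Fin n ⊕ Fin p) K) =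
          diagonalPart (segreLetter m n p) ![0, i, j] (q * g) := by
    intro g hg
    induction hg using Submodule.span_induction with
    | mem g hg =>
      obtain ⟨x, hx, rfl⟩ := hg
      intro q
      refine ⟨(⟨_, diagonalPart_mem_segreRing q⟩ : segreRing K m n p) • x, L.smul_mem _ hx, ?_⟩
      rw [diagonalPart_mul q (mem_segreClassModule_iff.1 x.2)]
      rfl
    | zero => exact fun q => ⟨0, L.zero_mem, by simp⟩
    | add g h _ _ hg hh =>
      intro q
      obtain ⟨x, hx, hx'⟩ := hg q
      obtain ⟨y, hy, hy'⟩ := hh q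
      exact ⟨x + y, L.add_mem hx hy, by rw [mul_add, map_add, ← hx', ← hy']; rfl⟩
    | smul a g _ hg =>
      intro q
      obtain ⟨x, hx, hx'⟩ := hg (q * a)
      exact ⟨x, hx, by rw [hx', smul_eq_mul, mul_assoc]⟩
  obtain ⟨x, hx, hx'⟩ := key f hf 1
  have h1 : diagonalPart (segreLetter m n p) ![0, i, j]
      (f : MvPolynomial (Fin m ⊕ Fin n ⊕ Fin p) K) = f := by
    ext σ
    rw [coeff_diagonalPart]
    split_ifs with h
    · rfl
    · by_contra h0
      exact h (mem_segreClassModule_iff.1 f.2 σ (Ne.symm h0))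
  rw [one_mul, h1] at hx'
  rwa [← Subtype.ext hx']

lemma isNoetherian_segreClassModule (i j : ℤ) :
    IsNoetherian (segreRing K m n p) (segreClassModule K m n p i j) := by
  rw [isNoetherian_iff']
  let F : Submodule (segreRing K m n p) (segreClassModule K m n p i j) →
      Ideal (MvPolynomial (Fin m ⊕ Fin n ⊕ Fin p) K) :=
    fun L => Ideal.span (Subtype.val '' (L : Set (segreClassModule K m n p i j)))
  have hF : StrictMono F := by
    intro L L' h
    refine lt_of_le_of_ne (Ideal.span_mono (Set.image_mono h.le)) fun heq => h.not_ge ?_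
    intro f hf
    refine mem_of_mem_span L f ?_
    change _ ∈ F L
    rw [heq]
    exact Ideal.subset_span ⟨f, hf, rfl⟩
  exact hF.wellFoundedGT

lemma isNoetherianRing_segreRing : IsNoetherianRing (segreRing K m n p) := by
  rw [isNoetherianRing_iff]
  have := isNoetherian_segreClassModule (K := K) (m := m) (n := n) (p := p) 0 0
  let F : segreRing K m n p →ₗ[segreRing K m n p] segreClassModule K m n p 0 0 :=
    { toFun := fun r => ⟨r, mem_segreClassModule_iff.2 fun σ hσ => by
        have h : ![(0 : ℤ), 0, 0] = 0 := by ext s; fin_cases s <;> rfl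
        rw [h]
        exact mem_segreRing_iff.1 r.2 σ hσ⟩
      map_add' := fun _ _ => rfl
      map_smul' := fun _ _ => rfl }
  exact isNoetherian_of_injective F fun r s h =>
    Subtype.ext (congrArg (fun f : segreClassModule K m n p 0 0 =>
      (f : MvPolynomial (Fin m ⊕ Fin n ⊕ Fin p) K)) h)

lemma exists_ne_zero_segreClassModule (hm : 0 < m) (hn : 0 < n) (hp : 0 < p) (i j : ℤ) :
    ∃ f : segreClassModule K m n p i j, f ≠ 0 := by
  let σ : Fin m ⊕ Fin n ⊕ Fin p →₀ ℕ :=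
    Finsupp.single (Sum.inl ⟨0, hm⟩) (|i| + |j|).toNat +
    Finsupp.single (Sum.inr (Sum.inl ⟨0, hn⟩)) (|i| + |j| - i).toNat +
    Finsupp.single (Sum.inr (Sum.inr ⟨0, hp⟩)) (|i| + |j| - j).toNat
  have hσ : IsDiagonal (segreLetter m n p) ![0, i, j] σ := by
    refine ⟨|i| + |j|, fun s => ?_⟩
    have h1 := le_abs_self i
    have h2 := le_abs_self j
    have h3 := abs_nonneg i
    have h4 := abs_nonneg j
    simp only [σ, letterDegree_add, letterDegree_single, segreLetter]
    fin_cases s <;> simp <;> omega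
  have hmem := isDiagonal_segreLetter_iff.1 hσ
  refine ⟨⟨monomial σ 1, Submodule.subset_span ⟨σ, hmem.1, hmem.2, rfl⟩⟩, fun h0 => ?_⟩
  have h1 : (monomial σ 1 : MvPolynomial (Fin m ⊕ Fin n ⊕ Fin p) K) = 0 :=
    congrArg Subtype.val h0
  simp at h1

lemma isRegular_of_isWeaklyRegular {R M : Type*} [CommRing R] [AddCommGroup M] [Module R M]
    [Module.Finite R M] {xs : List R} (h : RingTheory.Sequence.IsWeaklyRegular M xs)
    (hann : ∀ r : R, r - 1 ∈ Ideal.ofList xs → ¬ ∀ x : M, r • x = 0) :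
    RingTheory.Sequence.IsRegular M xs := by
  refine ⟨h, fun htop => ?_⟩
  obtain ⟨r, hr, hr0⟩ := Submodule.exists_sub_one_mem_and_smul_eq_zero_of_fg_of_le_smul
    (Ideal.ofList xs) (⊤ : Submodule R M) Module.Finite.fg_top htop.le
  exact hann r hr fun x => hr0 x trivial

lemma segreClassModule_isRegular_of_isWeaklyRegular (hm : 0 < m) (hn : 0 < n) (hp : 0 < p)
    (i j : ℤ) (xs : List (segreRing K m n p)) (hxs : ∀ x ∈ xs, x ∈ segreIrrelevantIdeal K m n p)
    (h : RingTheory.Sequence.IsWeaklyRegular (segreClassModule K m n p i j) xs) :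
    RingTheory.Sequence.IsRegular (segreClassModule K m n p i j) xs := by
  have := isNoetherian_segreClassModule (K := K) (m := m) (n := n) (p := p) i j
  refine isRegular_of_isWeaklyRegular h fun r hr hr0 => ?_
  obtain ⟨f, hf⟩ := exists_ne_zero_segreClassModule (K := K) hm hn hp i j
  have h1 : (r : MvPolynomial (Fin m ⊕ Fin n ⊕ Fin p) K) * f = 0 :=
    congrArg Subtype.val (hr0 f)
  have h2 : r = 0 := Subtype.ext ((mul_eq_zero.1 h1).resolve_right fun h0 => hf (Subtype.ext h0))
  have h3 : Ideal.ofList xs ≤ segreIrrelevantIdeal K m n p := Ideal.span_le.2 hxs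
  have h4 := coeff_zero_of_mem_segreIrrelevantIdeal _ (h3 hr)
  rw [h2] at h4
  simp at h4

end SegreNoetherian

/-- There is a regular sequence on `M_{(i,j)}` of length `m+n+p-2` (the Krull dimension
of `R`) consisting of elements of the irrelevant maximal ideal `𝔪` of `R` — i.e.
`M_{(i,j)}` is a Cohen–Macaulay `R`-module — if and only if at least two of the three
conditions `-(m-1) ≤ i ≤ n-1`, `-(m-1) ≤ j ≤ p-1`, `-(n-1) ≤ j-i ≤ p-1` hold. -/
theorem segreClassModule_cohenMacaulay_iff (K : Type*) [Field K] (m n p : ℕ)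
    (hm : 2 ≤ m) (hn : 2 ≤ n) (hp : 2 ≤ p) (i j : ℤ) :
    (∃ xs : List (segreRing K m n p), xs.length = m + n + p - 2 ∧
      (∀ x ∈ xs, x ∈ segreIrrelevantIdeal K m n p) ∧
      RingTheory.Sequence.IsRegular (segreClassModule K m n p i j) xs) ↔
    (((-(m - 1 : ℤ) ≤ i ∧ i ≤ n - 1) ∧ (-(m - 1 : ℤ) ≤ j ∧ j ≤ p - 1)) ∨
     ((-(m - 1 : ℤ) ≤ i ∧ i ≤ n - 1) ∧ (-(n - 1 : ℤ) ≤ j - i ∧ j - i ≤ p - 1)) ∨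
     ((-(m - 1 : ℤ) ≤ j ∧ j ≤ p - 1) ∧ (-(n - 1 : ℤ) ≤ j - i ∧ j - i ≤ p - 1))) := by
  obtain ⟨hX, hY, hZ⟩ := letterCount_segreLetter (m := m) (n := n) (p := p)
  have hdepth := extDepthGE_iff_depthCondition
    (isDiagonal_of_coeff_segreRing (K := K) (m := m) (n := n) (p := p))
    coeff_zero_of_mem_segreIrrelevantIdeal exists_mem_segreIrrelevantIdeal
    Finset.univ ![0, i, j] (by
      intro s
      fin_cases s
      · exact hX ▸ (by omega)
      · exact hY ▸ (by omega)
      · exact hZ ▸ (by omega)) (m + n + p - 2) (by rw [hX, hY, hZ]; omega)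
  rw [hX, hY, hZ] at hdepth
  refine Iff.trans ?_ (hdepth.trans ?_)
  swap
  · change DepthCondition m n p 0 i j (m + n + p - 2 : ℕ) ↔ _
    unfold DepthCondition
    omega
  constructor
  · rintro ⟨xs, hlen, hxs, hreg⟩
    rw [← hlen]
    exact ExtDepthGE.of_isWeaklyRegular xs hxs _
      (((segreClassModuleEquiv i j).isWeaklyRegular_congr xs).1 hreg.1)
  · intro h
    have := isNoetherianRing_segreRing (K := K) (m := m) (n := n) (p := p)
    have := isNoetherian_segreClassModule (K := K) (m := m) (n := n) (p := p) i j
    have := Module.Finite.equiv (segreClassModuleEquiv (K := K) (m := m) (n := n) (p := p) i j)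
    obtain ⟨xs, hlen, hxs, hreg⟩ := ExtDepthGE.exists_isWeaklyRegular _ _ h
    exact ⟨xs, hlen, hxs, segreClassModule_isRegular_of_isWeaklyRegular (by omega) (by omega)
      (by omega) i j xs hxs (((segreClassModuleEquiv i j).isWeaklyRegular_congr xs).2 hreg)⟩
end

section
/- For every i ∈ ℤ, the R-module M_i is nonzero and finitely generated, and there exists a monomial w ∈ P such that multiplication by w maps M_i injectively into R; consequently M_i is isomorphic as an R-module to a nonzero ideal of R. -/
open MvPolynomial

/-- Sum of the `X`-exponents of a monomial exponent vector. -/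
def xsum (m n : ℕ) (σ : (Fin m ⊕ Fin n) →₀ ℕ) : ℤ :=
  ∑ a : Fin m, (σ (Sum.inl a) : ℤ)

/-- Sum of the `Y`-exponents of a monomial exponent vector. -/
def ysum (m n : ℕ) (σ : (Fin m ⊕ Fin n) →₀ ℕ) : ℤ :=
  ∑ b : Fin n, (σ (Sum.inr b) : ℤ)

/-- The Segre product `R = R₁^{(c)} # R₂^{(d)}` of the `c`-th Veronese subring of
`K[X₁,…,X_m]` and the `d`-th Veronese subring of `K[Y₁,…,Y_n]`: the `K`-subalgebra of
`P = K[X₁,…,X_m,Y₁,…,Y_n]` spanned by all monomials with `d|α| = c|β|`. -/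
noncomputable def veroneseSegreRing (K : Type*) [Field K] (m n c d : ℕ) :
    Subalgebra K (MvPolynomial (Fin m ⊕ Fin n) K) :=
  Algebra.adjoin K
    {f | ∃ σ, (d : ℤ) * xsum m n σ = (c : ℤ) * ysum m n σ ∧ f = monomial σ (1 : K)}

/-- The class module `M_i`: the subspace of `P` spanned by all monomials with
`d|α| - c|β| = i`, as a module over `R = R₁^{(c)} # R₂^{(d)}`. -/
noncomputable def veroneseSegreClassModule (K : Type*) [Field K] (m n c d : ℕ) (i : ℤ) :
    Submodule (veroneseSegreRing K m n c d) (MvPolynomial (Fin m ⊕ Fin n) K) :=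
  Submodule.span (veroneseSegreRing K m n c d)
    {f | ∃ σ, (d : ℤ) * xsum m n σ - (c : ℤ) * ysum m n σ = i ∧ f = monomial σ (1 : K)}

/-- The weight `d|α| - c|β|` of the monomial `X^α Y^β`. -/
noncomputable def segreWeight (m n c d : ℕ) : ((Fin m ⊕ Fin n) →₀ ℕ) →+ ℤ where
  toFun σ := (d : ℤ) * xsum m n σ - (c : ℤ) * ysum m n σ
  map_zero' := by simp [xsum, ysum]
  map_add' σ τ := by
    simp only [xsum, ysum, Finsupp.add_apply, Nat.cast_add, Finset.sum_add_distrib]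
    ring

lemma segreWeight_apply (m n c d : ℕ) (σ : (Fin m ⊕ Fin n) →₀ ℕ) :
    segreWeight m n c d σ = (d : ℤ) * xsum m n σ - (c : ℤ) * ysum m n σ := rfl

lemma segreWeight_surjective {m n c d : ℕ} (hm : 1 ≤ m) (hn : 1 ≤ n) (hc : 1 ≤ c) (hd : 1 ≤ d)
    (hcd : Nat.Coprime c d) : Function.Surjective (segreWeight m n c d) := by
  intro i
  obtain ⟨u, v, huv⟩ : IsCoprime (c : ℤ) (d : ℤ) := Nat.isCoprime_iff_coprime.mpr hcd
  have hc' : (1 : ℤ) ≤ c := by exact_mod_cast hc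
  have hd' : (1 : ℤ) ≤ d := by exact_mod_cast hd
  obtain ⟨a, ha⟩ := Int.eq_ofNat_of_zero_le
    (show 0 ≤ i * v + c * (|i * v| + |i * u|) by
      nlinarith [neg_abs_le (i * v), abs_nonneg (i * v), abs_nonneg (i * u)])
  obtain ⟨b, hb⟩ := Int.eq_ofNat_of_zero_le
    (show 0 ≤ -(i * u) + d * (|i * v| + |i * u|) by
      nlinarith [le_abs_self (i * u), abs_nonneg (i * v), abs_nonneg (i * u)])
  refine ⟨Finsupp.single (Sum.inl ⟨0, hm⟩) a + Finsupp.single (Sum.inr ⟨0, hn⟩) b, ?_⟩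
  simp only [segreWeight_apply, xsum, ysum, Finsupp.add_apply, Finsupp.single_apply,
    Sum.inl.injEq, Sum.inr.injEq, reduceCtorEq, if_false, add_zero, zero_add, Nat.cast_ite,
    Nat.cast_zero, Finset.sum_ite_eq, Finset.mem_univ, if_true]
  linear_combination i * huv - d * ha + c * hb

lemma monomial_mem_veroneseSegreRing {K : Type*} [Field K] {m n c d : ℕ}
    {σ : (Fin m ⊕ Fin n) →₀ ℕ} (hσ : segreWeight m n c d σ = 0) :
    monomial σ (1 : K) ∈ veroneseSegreRing K m n c d :=
  Algebra.subset_adjoin ⟨σ, sub_eq_zero.mp hσ, rfl⟩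

lemma monomial_mem_veroneseSegreClassModule {K : Type*} [Field K] {m n c d : ℕ} {i : ℤ}
    {σ : (Fin m ⊕ Fin n) →₀ ℕ} (hσ : segreWeight m n c d σ = i) :
    monomial σ (1 : K) ∈ veroneseSegreClassModule K m n c d i :=
  Submodule.subset_span ⟨σ, hσ, rfl⟩

lemma monomial_mul_mem_veroneseSegreRing {K : Type*} [Field K] {m n c d : ℕ} {i : ℤ}
    {τ : (Fin m ⊕ Fin n) →₀ ℕ} (hτ : segreWeight m n c d τ = -i)
    {f : MvPolynomial (Fin m ⊕ Fin n) K} (hf : f ∈ veroneseSegreClassModule K m n c d i) :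
    monomial τ (1 : K) * f ∈ veroneseSegreRing K m n c d := by
  induction hf using Submodule.span_induction with
  | mem f hf =>
    obtain ⟨σ, hσ, rfl⟩ := hf
    rw [monomial_mul, one_mul]
    exact monomial_mem_veroneseSegreRing
      (by rw [map_add, hτ, segreWeight_apply, hσ, neg_add_cancel])
  | zero => rw [mul_zero]; exact zero_mem _
  | add f g _ _ hf hg => rw [mul_add]; exact add_mem hf hg
  | smul r f _ hf =>
    rw [Subalgebra.smul_def, smul_eq_mul, mul_left_comm]
    exact mul_mem r.2 hf

/-- By Dickson's lemma, the monomials of weight `i` that are minimal for divisibility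
generate `M_i`. -/
lemma veroneseSegreClassModule_fg (K : Type*) [Field K] (m n c d : ℕ) (i : ℤ) :
    (veroneseSegreClassModule K m n c d i).FG := by
  set S : Set ((Fin m ⊕ Fin n) →₀ ℕ) := {σ | segreWeight m n c d σ = i}
  have hfin : {σ | Minimal (· ∈ S) σ}.Finite :=
    (setOfPred_minimal_antichain _).finite_of_partiallyWellOrderedOn
      (Set.isPWO_of_wellQuasiOrderedLE _)
  refine Submodule.fg_def.mpr ⟨_, hfin.image fun σ => monomial σ (1 : K), le_antisymm ?_ ?_⟩
  · rw [Submodule.span_le]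
    rintro _ ⟨σ, hσ, rfl⟩
    exact monomial_mem_veroneseSegreClassModule hσ.prop
  · refine Submodule.span_le.mpr ?_
    rintro _ ⟨σ, hσ, rfl⟩
    obtain ⟨ρ, hρσ, hρ⟩ := exists_minimal_le_of_wellFoundedLT (· ∈ S) σ hσ
    obtain ⟨δ, rfl⟩ := exists_add_of_le hρσ
    have hδ : segreWeight m n c d δ = 0 := by
      have h₁ : segreWeight m n c d ρ = i := hρ.prop
      have h₂ : segreWeight m n c d (ρ + δ) = i := hσ
      rw [map_add] at h₂
      linarith
    have h := Submodule.smul_mem _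
      (⟨monomial δ (1 : K), monomial_mem_veroneseSegreRing hδ⟩ : veroneseSegreRing K m n c d)
      (Submodule.subset_span (R := veroneseSegreRing K m n c d)
        (Set.mem_image_of_mem (fun σ => monomial σ (1 : K))
          (show ρ ∈ {σ | Minimal (· ∈ S) σ} from hρ)))
    rwa [Subalgebra.smul_def, smul_eq_mul, monomial_mul, one_mul, add_comm δ ρ] at h

set_option synthInstance.maxHeartbeats 1000000
set_option maxHeartbeats 1000000

/-- Each `M_i` is a nonzero finitely generated `R`-module, there is a monomial `w ∈ P`
such that multiplication by `w` maps `M_i` injectively into `R`, and consequently `M_i`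
is isomorphic as an `R`-module to a nonzero ideal of `R`. -/
theorem veroneseSegreClassModule_isomorphic_to_ideal (K : Type*) [Field K] (m n c d : ℕ)
    (hm : 1 ≤ m) (hn : 1 ≤ n) (hc : 1 ≤ c) (hd : 1 ≤ d) (hcd : Nat.Coprime c d) (i : ℤ) :
    veroneseSegreClassModule K m n c d i ≠ ⊥ ∧
    (veroneseSegreClassModule K m n c d i).FG ∧
    (∃ τ : (Fin m ⊕ Fin n) →₀ ℕ,
      (∀ f ∈ veroneseSegreClassModule K m n c d i,
        MvPolynomial.monomial τ (1 : K) * f ∈ veroneseSegreRing K m n c d) ∧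
      Function.Injective (fun f : veroneseSegreClassModule K m n c d i =>
        MvPolynomial.monomial τ (1 : K) * (f : MvPolynomial (Fin m ⊕ Fin n) K))) ∧
    (∃ I : Ideal (veroneseSegreRing K m n c d), I ≠ ⊥ ∧
      Nonempty ((veroneseSegreClassModule K m n c d i) ≃ₗ[veroneseSegreRing K m n c d] I)) := by
  have hsurj := segreWeight_surjective hm hn hc hd hcd
  obtain ⟨σ, hσ⟩ := hsurj i
  obtain ⟨τ, hτ⟩ := hsurj (-i)
  have hne : veroneseSegreClassModule K m n c d i ≠ ⊥ := by
    intro h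
    have hmem := monomial_mem_veroneseSegreClassModule (K := K) hσ
    rw [h, Submodule.mem_bot, monomial_eq_zero] at hmem
    exact one_ne_zero hmem
  have hinj : Function.Injective (fun f : veroneseSegreClassModule K m n c d i =>
      monomial τ (1 : K) * (f : MvPolynomial (Fin m ⊕ Fin n) K)) := fun f g hfg =>
    Subtype.ext (mul_left_cancel₀ (by simp [monomial_eq_zero]) hfg)
  let φ : veroneseSegreClassModule K m n c d i →ₗ[veroneseSegreRing K m n c d]
      veroneseSegreRing K m n c d :=
    { toFun := fun f => ⟨monomial τ (1 : K) * f, monomial_mul_mem_veroneseSegreRing hτ f.2⟩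
      map_add' := fun f g => Subtype.ext (mul_add _ _ _)
      map_smul' := fun r f => Subtype.ext (mul_left_comm _ _ _) }
  have hφ : Function.Injective φ := fun f g hfg => hinj (congrArg Subtype.val hfg)
  refine ⟨hne, veroneseSegreClassModule_fg K m n c d i,
    ⟨τ, fun f hf => monomial_mul_mem_veroneseSegreRing hτ hf, hinj⟩,
    LinearMap.range φ, fun hbot => hne ?_, ⟨LinearEquiv.ofInjective φ hφ⟩⟩
  refine (Submodule.eq_bot_iff _).mpr fun f hf => ?_
  have hzero : φ ⟨f, hf⟩ = φ 0 := by rw [LinearMap.range_eq_bot.mp hbot]; rfl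
  exact congrArg Subtype.val (hφ hzero)
end

section
/- Let m, n, c, d, u, v ≥ 1 be integers with cu − dv = 1. Then every integer i with −dm+1 ≤ i ≤ cn−1 satisfies both inequalities 1 − ⌈(m − vi)/c⌉ ≤ ⌈ui/d⌉ and 1 − ⌈(n − ui)/d⌉ ≤ ⌈vi/c⌉; in particular, the set of integers i satisfying both inequalities has at least dm + cn − 1 elements. (These i are exactly the divisor classes for which the Stückrad–Vogel criterion certifies that M_i is Cohen–Macaulay, so the Segre product of the two Veronese subrings has at least dm + cn − 1 Cohen–Macaulay classes.) -/
theorem one_sub_ceil_le_ceil_of_add_pos {x y : ℚ} (h : 0 < x + y) : 1 - ⌈x⌉ ≤ ⌈y⌉ := by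
  have hsum : (0 : ℚ) < ((⌈x⌉ + ⌈y⌉ : ℤ) : ℚ) := by
    push_cast
    exact h.trans_le (add_le_add (Int.le_ceil x) (Int.le_ceil y))
  have : 0 < ⌈x⌉ + ⌈y⌉ := by exact_mod_cast hsum
  lia


/-- For `m, n, c, d, u, v ≥ 1` with `cu - dv = 1`, every integer `i` with
`-dm + 1 ≤ i ≤ cn - 1` satisfies both Stückrad–Vogel inequalities
`1 - ⌈(m - vi)/c⌉ ≤ ⌈ui/d⌉` and `1 - ⌈(n - ui)/d⌉ ≤ ⌈vi/c⌉`; in particular the set of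
integers satisfying both inequalities has at least `dm + cn - 1` elements, so the Segre
product of the two Veronese subrings has at least `dm + cn - 1` Cohen–Macaulay classes. -/
theorem atLeast_SV_classes (m n c d u v : ℤ) (hm : 1 ≤ m) (hn : 1 ≤ n) (hc : 1 ≤ c)
    (hd : 1 ≤ d) (hu : 1 ≤ u) (hv : 1 ≤ v) (huv : c * u - d * v = 1) :
    (∀ i : ℤ, -d * m + 1 ≤ i → i ≤ c * n - 1 →
      (1 - ⌈((m : ℚ) - v * i) / (c : ℚ)⌉ ≤ ⌈(u : ℚ) * i / (d : ℚ)⌉ ∧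
       1 - ⌈((n : ℚ) - u * i) / (d : ℚ)⌉ ≤ ⌈(v : ℚ) * i / (c : ℚ)⌉)) ∧
    (∃ T : Finset ℤ,
      (↑T : Set ℤ) ⊆ {i : ℤ |
        1 - ⌈((m : ℚ) - v * i) / (c : ℚ)⌉ ≤ ⌈(u : ℚ) * i / (d : ℚ)⌉ ∧
        1 - ⌈((n : ℚ) - u * i) / (d : ℚ)⌉ ≤ ⌈(v : ℚ) * i / (c : ℚ)⌉} ∧
      (T.card : ℤ) = d * m + c * n - 1) := by
  have hcQ : (0 : ℚ) < c := by exact_mod_cast hc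
  have hdQ : (0 : ℚ) < d := by exact_mod_cast hd
  have huvQ : (c : ℚ) * u - d * v = 1 := by exact_mod_cast huv
  have key : ∀ i : ℤ, -d * m + 1 ≤ i → i ≤ c * n - 1 →
      (1 - ⌈((m : ℚ) - v * i) / (c : ℚ)⌉ ≤ ⌈(u : ℚ) * i / (d : ℚ)⌉ ∧
       1 - ⌈((n : ℚ) - u * i) / (d : ℚ)⌉ ≤ ⌈(v : ℚ) * i / (c : ℚ)⌉) := by
    intro i hlo hhi
    have hlo' : -(d : ℚ) * m + 1 ≤ i := by exact_mod_cast hlo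
    have hhi' : (i : ℚ) ≤ c * n - 1 := by exact_mod_cast hhi
    constructor <;> apply one_sub_ceil_le_ceil_of_add_pos
    · rw [div_add_div _ _ hcQ.ne' hdQ.ne']
      refine div_pos ?_ (by positivity)
      linear_combination hlo' - (i : ℚ) * huvQ
    · rw [div_add_div _ _ hdQ.ne' hcQ.ne']
      refine div_pos ?_ (by positivity)
      linear_combination hhi' + (i : ℚ) * huvQ
  refine ⟨key, Finset.Icc (-d * m + 1) (c * n - 1), fun i hi => ?_, ?_⟩
  · obtain ⟨hlo, hhi⟩ := Finset.mem_Icc.mp (Finset.mem_coe.mp hi)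
    exact key i hlo hhi
  · have hdm : 1 ≤ d * m := one_le_mul_of_one_le_of_one_le hd hm
    have hcn : 1 ≤ c * n := one_le_mul_of_one_le_of_one_le hc hn
    rw [Int.card_Icc, Int.toNat_of_nonneg (by linarith)]
    ring
end

section
/- Let m, n, d, u, v ≥ 1 be integers with u − dv = 1 (the case c = 1). Then the set of integers i satisfying both inequalities 1 − ⌈(m − vi)/1⌉ ≤ ⌈ui/d⌉ and 1 − ⌈(n − ui)/d⌉ ≤ ⌈vi/1⌉ is exactly { i ∈ ℤ : −dm+1 ≤ i ≤ n−1 }, and hence has exactly dm + n − 1 elements. (For c = 1 the ring R₁^{(1)} # R₂^{(d)} has exactly dm + n − 1 Cohen–Macaulay classes.) -/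
/-- For `c = 1`: if `m, n, d, u, v ≥ 1` and `u - dv = 1`, then the set of integers `i`
satisfying both Stückrad–Vogel inequalities `1 - ⌈(m - vi)/1⌉ ≤ ⌈ui/d⌉` and
`1 - ⌈(n - ui)/d⌉ ≤ ⌈vi/1⌉` is exactly `{i : -dm + 1 ≤ i ≤ n - 1}`, and hence has
exactly `dm + n - 1` elements: for `c = 1` the ring `R₁^{(1)} # R₂^{(d)}` has exactly
`dm + n - 1` Cohen–Macaulay classes. -/
theorem SV_classes_c_eq_one (m n d u v : ℤ) (hm : 1 ≤ m) (hn : 1 ≤ n) (hd : 1 ≤ d)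
    (hu : 1 ≤ u) (hv : 1 ≤ v) (huv : u - d * v = 1) :
    {i : ℤ |
      1 - ⌈((m : ℚ) - v * i) / (1 : ℚ)⌉ ≤ ⌈(u : ℚ) * i / (d : ℚ)⌉ ∧
      1 - ⌈((n : ℚ) - u * i) / (d : ℚ)⌉ ≤ ⌈(v : ℚ) * i / (1 : ℚ)⌉} =
      Set.Icc (-d * m + 1) (n - 1) ∧
    (({i : ℤ |
      1 - ⌈((m : ℚ) - v * i) / (1 : ℚ)⌉ ≤ ⌈(u : ℚ) * i / (d : ℚ)⌉ ∧
      1 - ⌈((n : ℚ) - u * i) / (d : ℚ)⌉ ≤ ⌈(v : ℚ) * i / (1 : ℚ)⌉}).ncard : ℤ) =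
      d * m + n - 1 := by
  have key : {i : ℤ |
      1 - ⌈((m : ℚ) - v * i) / (1 : ℚ)⌉ ≤ ⌈(u : ℚ) * i / (d : ℚ)⌉ ∧
      1 - ⌈((n : ℚ) - u * i) / (d : ℚ)⌉ ≤ ⌈(v : ℚ) * i / (1 : ℚ)⌉} =
      Set.Icc (-d * m + 1) (n - 1) := by
    obtain rfl : u = 1 + d * v := by linarith
    have hd' : (0 : ℚ) < d := by exact_mod_cast hd
    ext i
    have h₁ : ⌈((m : ℚ) - v * i) / (1 : ℚ)⌉ = m - v * i := by
      rw [div_one]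
      exact_mod_cast Int.ceil_intCast (R := ℚ) (m - v * i)
    have h₂ : ⌈(v : ℚ) * i / (1 : ℚ)⌉ = v * i := by
      rw [div_one]
      exact_mod_cast Int.ceil_intCast (R := ℚ) (v * i)
    have h₃ : ⌈((1 + d * v : ℤ) : ℚ) * i / (d : ℚ)⌉ = ⌈(i : ℚ) / d⌉ + v * i := by
      rw [← Int.ceil_add_intCast]
      congr 1
      push_cast
      field_simp
    have h₄ : ⌈((n : ℚ) - (1 + d * v : ℤ) * i) / (d : ℚ)⌉ = ⌈((n - i : ℤ) : ℚ) / d⌉ - v * i := by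
      rw [← Int.ceil_sub_intCast]
      congr 1
      push_cast
      field_simp
      ring
    have h₅ : -m < ⌈(i : ℚ) / d⌉ ↔ -d * m < i := by
      rw [Int.lt_ceil, lt_div_iff₀ hd']
      norm_cast
      rw [mul_comm, mul_neg, neg_mul]
    have h₆ : 0 < ⌈((n - i : ℤ) : ℚ) / d⌉ ↔ i < n := by
      rw [Int.ceil_pos, div_pos_iff_of_pos_right hd', Int.cast_pos, sub_pos]
    rw [Set.mem_ofPred_eq, Set.mem_Icc, h₁, h₂, h₃, h₄]
    refine and_congr ?_ ?_
    · rw [Int.add_one_le_iff, ← h₅]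
      constructor <;> intro h <;> linarith
    · rw [Int.le_sub_one_iff, ← h₆]
      constructor <;> intro h <;> linarith
  refine ⟨key, ?_⟩
  rw [key, Set.ncard_eq_toFinset_card', Set.toFinset_Icc, Int.card_Icc, Int.toNat_of_nonneg]
  · ring
  · nlinarith
end

section
/- Let c, d ≥ 2 be coprime integers and let u, v ≥ 1 be integers with cu − dv = 1. Then the set of integers i satisfying both inequalities 1 − ⌈(1 − vi)/c⌉ ≤ ⌈ui/d⌉ and 1 − ⌈(1 − ui)/d⌉ ≤ ⌈vi/c⌉ is finite and has cardinality strictly greater than c + d − 1. (This is the case m = n = 1: the number of Cohen–Macaulay classes of K[X]^{(c)} # K[Y]^{(d)} is strictly greater than c + d − 1, the number of conic classes.) -/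
theorem Int.ceil_one_sub_div (x d : ℤ) (hd : 0 < d) :
    ⌈((1 : ℚ) - x) / (d : ℚ)⌉ = 1 - ⌈(x : ℚ) / (d : ℚ)⌉ := by
  have hdq : (0 : ℚ) < d := by exact_mod_cast hd
  obtain ⟨h₁, h₂⟩ := Int.ceil_eq_iff.mp (rfl : ⌈(x : ℚ) / (d : ℚ)⌉ = _)
  generalize ⌈(x : ℚ) / (d : ℚ)⌉ = k at h₁ h₂ ⊢
  rw [lt_div_iff₀ hdq] at h₁
  rw [div_le_iff₀ hdq] at h₂
  rw [Int.ceil_eq_iff, lt_div_iff₀ hdq, div_le_iff₀ hdq]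
  norm_cast at h₁ h₂ ⊢
  constructor <;> linarith [Int.add_one_le_iff.mpr h₁]

theorem Int.ceil_mul_add_mul_div (a i d m : ℤ) (hd : d ≠ 0) :
    ⌈(a : ℚ) * ((i + d * m : ℤ) : ℚ) / (d : ℚ)⌉ = ⌈(a : ℚ) * i / (d : ℚ)⌉ + a * m := by
  have hdq : (d : ℚ) ≠ 0 := by exact_mod_cast hd
  rw [← Int.ceil_add_intCast]
  congr 1
  push_cast
  field_simp

/-- A function on `ℤ` that increases by one along each step of length `N` has exactly one zero
in each residue class modulo `N`. -/
theorem Int.finite_and_ncard_zeros_of_quasiperiodic (N : ℤ) (hN : 0 < N) (f : ℤ → ℤ)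
    (hf : ∀ i k, f (i + N * k) = f i + k) :
    {i | f i = 0}.Finite ∧ ({i | f i = 0}.ncard : ℤ) = N := by
  have himage : {i | f i = 0} = (fun r => r + N * (-f r)) '' (Finset.Ico 0 N : Set ℤ) := by
    ext i
    constructor
    · intro hi
      have h := hf (i % N) (i / N)
      rw [Int.emod_add_mul_ediv] at h
      refine ⟨i % N, by simp [Int.emod_nonneg i hN.ne', Int.emod_lt_of_pos i hN], ?_⟩
      have hq : -f (i % N) = i / N := by
        have : f i = 0 := hi
        linarith
      simp only [hq, Int.emod_add_mul_ediv]
    · rintro ⟨r, -, rfl⟩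
      exact (hf r (-f r)).trans (add_neg_cancel _)
  have hinj : Set.InjOn (fun r => r + N * (-f r)) (Finset.Ico 0 N : Set ℤ) := by
    intro r hr s hs h
    simp only [Finset.coe_Ico, Set.mem_Ico] at hr hs
    have := congrArg (· % N) h
    simpa only [Int.add_mul_emod_self_left, Int.emod_eq_of_lt hr.1 hr.2,
      Int.emod_eq_of_lt hs.1 hs.2] using this
  rw [himage]
  refine ⟨(Finset.finite_toSet _).image _, ?_⟩
  rw [hinj.ncard_image, Set.ncard_coe_finset, Int.card_Ico]
  omega

/-- For `m = n = 1`: if `c, d ≥ 2` are coprime and `u, v ≥ 1` satisfy `cu - dv = 1`,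
then the set of integers `i` satisfying both Stückrad–Vogel inequalities
`1 - ⌈(1 - vi)/c⌉ ≤ ⌈ui/d⌉` and `1 - ⌈(1 - ui)/d⌉ ≤ ⌈vi/c⌉` is finite and has
cardinality strictly greater than `c + d - 1`: the number of Cohen–Macaulay classes of
`K[X]^{(c)} # K[Y]^{(d)}` is strictly greater than the number `c + d - 1` of conic
classes. -/
theorem SV_classes_m_eq_n_eq_one (c d u v : ℤ) (hc : 2 ≤ c) (hd : 2 ≤ d)
    (hcd : IsCoprime c d) (hu : 1 ≤ u) (hv : 1 ≤ v) (huv : c * u - d * v = 1) :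
    ({i : ℤ |
      1 - ⌈((1 : ℚ) - v * i) / (c : ℚ)⌉ ≤ ⌈(u : ℚ) * i / (d : ℚ)⌉ ∧
      1 - ⌈((1 : ℚ) - u * i) / (d : ℚ)⌉ ≤ ⌈(v : ℚ) * i / (c : ℚ)⌉}).Finite ∧
    c + d - 1 < (({i : ℤ |
      1 - ⌈((1 : ℚ) - v * i) / (c : ℚ)⌉ ≤ ⌈(u : ℚ) * i / (d : ℚ)⌉ ∧
      1 - ⌈((1 : ℚ) - u * i) / (d : ℚ)⌉ ≤ ⌈(v : ℚ) * i / (c : ℚ)⌉}).ncard : ℤ) := by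
  have hset : {i : ℤ |
      1 - ⌈((1 : ℚ) - v * i) / (c : ℚ)⌉ ≤ ⌈(u : ℚ) * i / (d : ℚ)⌉ ∧
      1 - ⌈((1 : ℚ) - u * i) / (d : ℚ)⌉ ≤ ⌈(v : ℚ) * i / (c : ℚ)⌉} =
      {i : ℤ | ⌈(u : ℚ) * i / (d : ℚ)⌉ - ⌈(v : ℚ) * i / (c : ℚ)⌉ = 0} := by
    ext i
    have hci := Int.ceil_one_sub_div (v * i) c (by omega)
    have hdi := Int.ceil_one_sub_div (u * i) d (by omega)
    push_cast at hci hdi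
    simp only [Set.mem_ofPred_eq, hci, hdi]
    omega
  obtain ⟨hfin, hcard⟩ := Int.finite_and_ncard_zeros_of_quasiperiodic (c * d) (by positivity)
    (fun i => ⌈(u : ℚ) * i / (d : ℚ)⌉ - ⌈(v : ℚ) * i / (c : ℚ)⌉) (by
      intro i k
      have hdi := Int.ceil_mul_add_mul_div u i d (c * k) (by omega)
      have hci := Int.ceil_mul_add_mul_div v i c (d * k) (by omega)
      rw [show i + d * (c * k) = i + c * d * k by ring] at hdi
      rw [show i + c * (d * k) = i + c * d * k by ring] at hci
      simp only [hdi, hci]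
      linear_combination k * huv)
  rw [hset]
  refine ⟨hfin, ?_⟩
  rw [hcard]
  nlinarith
end
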